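/- arXiv:1202.2550 — 4 statements merged into one kernel-verified Lean document; each statement's English description precedes it below -/
import Mathlib

section
/- Karamata representation for the Fréchet domain: a distribution function F belongs to D(φ_γ) for some γ > 0 if and only if there exist a constant c > 0 and measurable functions f, b : (0,1) → ℝ with f(u) → 0 and b(u) → 0 as u → 0+, such that t ↦ b(t)/t is integrable on (u,1) for every u ∈ (0,1) and, for all 0 < u < 1, F⁻¹(1 − u) = c (1 + f(u)) u^{−1/γ} exp(∫_u^1 b(t) t^{−1} dt). -/
open MeasureTheory Filter Topology Set

noncomputable section

/-- A distribution function: nondecreasing, right-continuous, with limits 0 at -∞ and 1 at +∞. -/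
def IsDF (F : ℝ → ℝ) : Prop :=
  Monotone F ∧ (∀ x, ContinuousWithinAt F (Set.Ici x) x) ∧
    Tendsto F atBot (𝓝 0) ∧ Tendsto F atTop (𝓝 1)

/-- `F` lies in the domain of attraction of `M`. -/
def MemDomAttr (F M : ℝ → ℝ) : Prop :=
  ∃ a b : ℕ → ℝ, (∀ n, 0 < a n) ∧
    ∀ x, ContinuousAt M x →
      Tendsto (fun n => F (a n * x + b n) ^ n) atTop (𝓝 (M x))

/-- The Gumbel distribution function Λ. -/
def gumbelDF (x : ℝ) : ℝ := Real.exp (-Real.exp (-x))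

/-- The Fréchet distribution function φ_γ. -/
def frechetDF (γ : ℝ) (x : ℝ) : ℝ := if 0 < x then Real.exp (-(x ^ (-γ))) else 0

/-- The Weibull distribution function ψ_γ. -/
def weibullDF (γ : ℝ) (x : ℝ) : ℝ := if x < 0 then Real.exp (-((-x) ^ γ)) else 1

/-- Generalized inverse `F⁻¹(u) = inf {x | F x ≥ u}`. -/
def genInv (F : ℝ → ℝ) (u : ℝ) : ℝ := sInf {x | u ≤ F x}

/-- Upper endpoint `x₀(F) = sup {x | F x < 1}`. -/
def upEnd (F : ℝ → ℝ) : ℝ := sSup {x | F x < 1}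

/-- Membership in `D(φ) = ⋃_{γ>0} D(φ_γ)`. -/
def MemFrechetDom (F : ℝ → ℝ) : Prop := ∃ γ, 0 < γ ∧ MemDomAttr F (frechetDF γ)

/-- Membership in `D(ψ) = ⋃_{γ>0} D(ψ_γ)`. -/
def MemWeibullDom (F : ℝ → ℝ) : Prop := ∃ γ, 0 < γ ∧ MemDomAttr F (weibullDF γ)

/-- Membership in `Γ = D(Λ) ∪ D(φ) ∪ D(ψ)`. -/
def MemGamma (F : ℝ → ℝ) : Prop :=
  MemDomAttr F gumbelDF ∨ MemFrechetDom F ∨ MemWeibullDom F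

/-- Iterated integral `x ↦ ∫_x^z dy_1 ∫_{y_1}^z ⋯ ∫_{y_p}^z (1 - H t) dt`. -/
def iterInt (H : ℝ → ℝ) (z : ℝ) : ℕ → ℝ → ℝ
  | 0 => fun x => ∫ t in x..z, (1 - H t)
  | (p + 1) => fun x => ∫ y in x..z, iterInt H z p y

/-- `Rp p x z H` is `R_p(x, z, H)` (for `p ≥ 1`). -/
def Rp (p : ℕ) (x z : ℝ) (H : ℝ → ℝ) : ℝ := (1 - H x)⁻¹ * iterInt H z (p - 1) x

/-- Iterated integral with upper endpoint `x₀(H)` (handled as an integral up to +∞,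
since `1 - H` vanishes beyond the upper endpoint). -/
def iterIntInf (H : ℝ → ℝ) : ℕ → ℝ → ℝ
  | 0 => fun x => ∫ t in Set.Ioi x, (1 - H t)
  | (p + 1) => fun x => ∫ y in Set.Ioi x, iterIntInf H p y

/-- `RpInf p x H` is `R_p(x, H) = R_p(x, x₀(H), H)` (for `p ≥ 1`). -/
def RpInf (p : ℕ) (x : ℝ) (H : ℝ → ℝ) : ℝ := (1 - H x)⁻¹ * iterIntInf H (p - 1) x

/-- Regular variation at zero with exponent `d`. -/
def RegVarAtZero (s : ℝ → ℝ) (d : ℝ) : Prop :=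
  ∀ l : ℝ, 0 < l → Tendsto (fun u => s (l * u) / s u) (𝓝[>] (0 : ℝ)) (𝓝 (l ^ d))

/-- `orderStat n j v`: the `j`-th smallest (1-indexed) among `v 0, …, v (n-1)`. -/
def orderStat (n j : ℕ) (v : ℕ → ℝ) : ℝ :=
  ((Multiset.map v (Multiset.range n)).sort (· ≤ ·)).getD (j - 1) 0

/-- Cumulative distribution function of the centered Gaussian law with variance `v`. -/
def gaussCdf (v : ℝ) (x : ℝ) : ℝ :=
  ((ProbabilityTheory.gaussianReal 0 v.toNNReal) (Set.Iic x)).toReal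


open Classical in
/-- The filter "x → x₀(G)⁻" of approach to the upper endpoint from below
(`atTop` when the upper endpoint is infinite). -/
def upEndFilter (G : ℝ → ℝ) : Filter ℝ :=
  if BddAbove {x | G x < 1} then 𝓝[<] (upEnd G) else atTop


lemma aux_nonneg {F : ℝ → ℝ} (hF : IsDF F) (x : ℝ) : 0 ≤ F x :=
  hF.1.le_of_tendsto hF.2.2.1 x

lemma aux_galois {F : ℝ → ℝ} (hF : IsDF F) {p : ℝ} (h0 : 0 < p) (h1 : p < 1) (y : ℝ) :
    genInv F p ≤ y ↔ p ≤ F y := by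
  obtain ⟨hm, hr, hb, ht⟩ := hF
  have hbdd : BddBelow {x | p ≤ F x} := by
    obtain ⟨z, hz⟩ := (hb.eventually (gt_mem_nhds h0)).exists
    refine ⟨z, fun x hx => ?_⟩
    by_contra hlt
    push Not at hlt
    have := hm hlt.le
    have hx' : p ≤ F x := hx
    linarith
  have hne : {x | p ≤ F x}.Nonempty := by
    obtain ⟨z, hz⟩ := (ht.eventually (lt_mem_nhds h1)).exists
    exact ⟨z, hz.le⟩
  constructor
  · intro h
    by_contra hlt
    push Not at hlt
    have h2 : ∀ᶠ z in 𝓝[>] y, F z < p :=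
      ((hr y).mono Ioi_subset_Ici_self).eventually (gt_mem_nhds hlt)
    obtain ⟨z, hz, hyz⟩ := (h2.and self_mem_nhdsWithin).exists
    have hyz' : y < z := hyz
    obtain ⟨w, hw, hwz⟩ := exists_lt_of_csInf_lt hne (lt_of_le_of_lt h hyz')
    have hw' : p ≤ F w := hw
    have := hm hwz.le
    linarith
  · intro h
    exact csInf_le hbdd h

lemma aux_anti {F : ℝ → ℝ} (hF : IsDF F) {u v : ℝ} (hu : 0 < u) (huv : u ≤ v) (hv : v < 1) :
    genInv F (1 - v) ≤ genInv F (1 - u) := by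
  rw [aux_galois hF (by linarith) (by linarith)]
  have := (aux_galois hF (p := 1 - u) (by linarith) (by linarith) (genInv F (1 - u))).1 le_rfl
  linarith

lemma aux_lt {γ : ℝ} (hγ : 0 < γ) {s x : ℝ} (hs : 0 < s) (h : x < s ^ (-(1 / γ))) :
    frechetDF γ x < Real.exp (-s) := by
  unfold frechetDF
  split_ifs with hx
  · rw [Real.exp_lt_exp, neg_lt_neg_iff]
    have := Real.rpow_lt_rpow_of_neg hx h (neg_lt_zero.2 hγ)
    rwa [← Real.rpow_mul hs.le, show -(1 / γ) * -γ = 1 by field_simp, Real.rpow_one] at this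
  · exact Real.exp_pos _

lemma aux_gt {γ : ℝ} (hγ : 0 < γ) {s x : ℝ} (hs : 0 < s) (h : s ^ (-(1 / γ)) < x) :
    Real.exp (-s) < frechetDF γ x := by
  have h0 : 0 < s ^ (-(1 / γ)) := Real.rpow_pos_of_pos hs _
  unfold frechetDF
  rw [if_pos (h0.trans h), Real.exp_lt_exp, neg_lt_neg_iff]
  have := Real.rpow_lt_rpow_of_neg h0 h (neg_lt_zero.2 hγ)
  rwa [← Real.rpow_mul hs.le, show -(1 / γ) * -γ = 1 by field_simp, Real.rpow_one] at this

lemma aux_cont {γ : ℝ} (hγ : 0 < γ) (x : ℝ) : ContinuousAt (frechetDF γ) x := by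
  have hmono : Monotone (frechetDF γ) := by
    intro a b hab
    unfold frechetDF
    split_ifs with h1 h2 h2
    · rw [Real.exp_le_exp, neg_le_neg_iff]
      exact Real.rpow_le_rpow_of_nonpos h1 hab (by linarith)
    · exact absurd (h1.trans_le hab) h2
    · exact (Real.exp_pos _).le
    · exact le_rfl
  rcases lt_trichotomy x 0 with hx | hx | hx
  · have : frechetDF γ =ᶠ[𝓝 x] fun _ => 0 := by
      filter_upwards [gt_mem_nhds hx] with y hy
      simp [frechetDF, not_lt.2 hy.le]
    exact continuousAt_const.congr this.symm
  · subst hx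
    have h0 : frechetDF γ 0 = 0 := by simp [frechetDF]
    have hnn : ∀ y, 0 ≤ frechetDF γ y := by
      intro y
      unfold frechetDF
      split_ifs
      · exact (Real.exp_pos _).le
      · exact le_rfl
    rw [ContinuousAt, h0, tendsto_order]
    refine ⟨fun a ha => Eventually.of_forall fun y => ha.trans_le (hnn y), fun a ha => ?_⟩
    obtain ⟨s, hs, hsa⟩ : ∃ s : ℝ, 0 < s ∧ Real.exp (-s) < a := by
      have := (Real.tendsto_exp_neg_atTop_nhds_zero.eventually (gt_mem_nhds ha)).and
        (eventually_gt_atTop 0)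
      obtain ⟨s, h1, h2⟩ := this.exists
      exact ⟨s, h2, h1⟩
    have h1 : 0 < s ^ (-(1 / γ)) := Real.rpow_pos_of_pos hs _
    filter_upwards [gt_mem_nhds h1] with y hy
    exact (aux_lt hγ hs hy).trans hsa
  · have : frechetDF γ =ᶠ[𝓝 x] fun y => Real.exp (-(y ^ (-γ))) := by
      filter_upwards [lt_mem_nhds hx] with y hy
      simp [frechetDF, hy]
    refine ContinuousAt.congr ?_ this.symm
    exact ((Real.continuousAt_rpow_const x _ (Or.inl hx.ne')).neg).rexp

lemma aux_exp (s : ℝ) :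
    Tendsto (fun n : ℕ => (1 - s / n) ^ n) atTop (𝓝 (Real.exp (-s))) := by
  have := Real.tendsto_one_add_div_pow_exp (-s)
  refine this.congr fun n => ?_
  rw [neg_div, sub_eq_add_neg]

lemma aux_small {s : ℝ} (hs : 0 < s) :
    ∀ᶠ n : ℕ in atTop, 0 < 1 - s / n ∧ 1 - s / n < 1 := by
  have h := (tendsto_const_div_atTop_nhds_zero_nat s).eventually (gt_mem_nhds zero_lt_one)
  filter_upwards [h, eventually_gt_atTop 0] with n h1 h2
  have : 0 < s / n := by positivity
  constructor <;> linarith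

/-- quantile convergence from the domain of attraction -/
lemma aux_quant {F : ℝ → ℝ} (hF : IsDF F) {γ : ℝ} (hγ : 0 < γ) {a b : ℕ → ℝ}
    (ha : ∀ n, 0 < a n)
    (h : ∀ x, Tendsto (fun n => F (a n * x + b n) ^ n) atTop (𝓝 (frechetDF γ x)))
    {s : ℝ} (hs : 0 < s) :
    Tendsto (fun n : ℕ => (genInv F (1 - s / n) - b n) / a n) atTop (𝓝 (s ^ (-(1 / γ)))) := by
  rw [tendsto_order]
  constructor
  · intro x hx
    have h1 := (h x).eventually_lt (aux_exp s) (aux_lt hγ hs hx)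
    filter_upwards [h1, aux_small hs] with n h1 h2
    have h3 : F (a n * x + b n) < 1 - s / n := lt_of_pow_lt_pow_left₀ n h2.1.le h1
    rw [← not_le, ← aux_galois hF h2.1 h2.2, not_le] at h3
    rw [lt_div_iff₀ (ha n)]
    linarith
  · intro x hx
    obtain ⟨x', hx1, hx2⟩ := exists_between hx
    have h1 := (aux_exp s).eventually_lt (h x') (aux_gt hγ hs hx1)
    filter_upwards [h1, aux_small hs] with n h1 h2
    have h3 : 1 - s / n < F (a n * x' + b n) := lt_of_pow_lt_pow_left₀ n (aux_nonneg hF _) h1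
    have h4 := (aux_galois hF h2.1 h2.2 _).2 h3.le
    rw [div_lt_iff₀ (ha n)]
    have := mul_lt_mul_of_pos_left hx2 (ha n)
    linarith

/-- converse -/
lemma aux_conv {F : ℝ → ℝ} (hF : IsDF F) {γ : ℝ} (hγ : 0 < γ) {a : ℕ → ℝ}
    (ha : ∀ n, 0 < a n)
    (h : ∀ s : ℝ, 0 < s → Tendsto (fun n : ℕ => genInv F (1 - s / n) / a n) atTop
      (𝓝 (s ^ (-(1 / γ))))) (x : ℝ) :
    Tendsto (fun n => F (a n * x) ^ n) atTop (𝓝 (frechetDF γ x)) := by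
  have key : ∀ s : ℝ, 0 < s → s ^ (-(1 / γ)) > x →
      ∀ᶠ n : ℕ in atTop, F (a n * x) ^ n ≤ (1 - s / n) ^ n := by
    intro s hs hx
    filter_upwards [(h s hs).eventually (lt_mem_nhds hx), aux_small hs] with n h1 h2
    rw [lt_div_iff₀ (ha n), ← not_le, aux_galois hF h2.1 h2.2, not_le, mul_comm] at h1
    exact pow_le_pow_left₀ (aux_nonneg hF _) h1.le n
  have key2 : ∀ s : ℝ, 0 < s → s ^ (-(1 / γ)) < x →
      ∀ᶠ n : ℕ in atTop, (1 - s / n) ^ n ≤ F (a n * x) ^ n := by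
    intro s hs hx
    filter_upwards [(h s hs).eventually (gt_mem_nhds hx), aux_small hs] with n h1 h2
    rw [div_lt_iff₀ (ha n)] at h1
    have h3 := (aux_galois hF h2.1 h2.2 _).1 h1.le
    rw [mul_comm] at h3
    exact pow_le_pow_left₀ h2.1.le h3 n
  have hs_ex : ∀ t : ℝ, 0 < t → t < 1 → ∃ s : ℝ, 0 < s ∧ Real.exp (-s) = t := by
    intro t h0 h1
    exact ⟨-Real.log t, by have := Real.log_neg h0 h1; linarith, by rw [neg_neg, Real.exp_log h0]⟩
  have hle1 : frechetDF γ x < 1 := by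
    unfold frechetDF
    split_ifs with hx
    · rw [Real.exp_lt_one_iff]
      have := Real.rpow_pos_of_pos hx (-γ)
      linarith
    · exact one_pos
  have hge0 : 0 ≤ frechetDF γ x := by
    unfold frechetDF
    split_ifs with hx
    · exact (Real.exp_pos _).le
    · exact le_rfl
  rw [tendsto_order]
  constructor
  · intro t ht
    by_cases ht0 : t < 0
    · exact Eventually.of_forall fun n => ht0.trans_le (pow_nonneg (aux_nonneg hF _) n)
    push Not at ht0
    obtain ⟨t', ht1, ht2⟩ := exists_between ht
    obtain ⟨s, hs, hst⟩ := hs_ex t' (by linarith) (by linarith)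
    have hx : s ^ (-(1 / γ)) < x := by
      obtain ⟨t'', ht3, ht4⟩ := exists_between ht2
      by_contra hc
      push Not at hc
      obtain ⟨s2, hs2, hst2⟩ := hs_ex t'' (by linarith) (by linarith)
      have hss : s2 < s := by
        have : Real.exp (-s) < Real.exp (-s2) := by rw [hst, hst2]; exact ht3
        rw [Real.exp_lt_exp] at this
        linarith
      have h5 : s ^ (-(1 / γ)) < s2 ^ (-(1 / γ)) :=
        Real.rpow_lt_rpow_of_neg hs2 hss (by rw [neg_lt_zero]; positivity)
      have := aux_lt hγ hs2 (hc.trans_lt h5)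
      linarith
    have h6 := (aux_exp s).eventually (lt_mem_nhds (show t < Real.exp (-s) by rw [hst]; exact ht1))
    filter_upwards [h6, key2 s hs hx] with n h1 h2
    linarith
  · intro t ht
    by_cases ht1 : 1 < t
    · filter_upwards [aux_small (s := 1) one_pos] with n _
      refine lt_of_le_of_lt (pow_le_one₀ (aux_nonneg hF _) ?_) ht1
      exact hF.1.ge_of_tendsto hF.2.2.2 _
    push Not at ht1
    obtain ⟨t', ht2, ht3⟩ := exists_between ht
    obtain ⟨s, hs, hst⟩ := hs_ex t' (by linarith) (by linarith)
    have hx : x < s ^ (-(1 / γ)) := by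
      obtain ⟨t'', ht4, ht5⟩ := exists_between ht2
      by_contra hc
      push Not at hc
      obtain ⟨s2, hs2, hst2⟩ := hs_ex t'' (by linarith) (by linarith)
      have hss : s < s2 := by
        have : Real.exp (-s2) < Real.exp (-s) := by rw [hst, hst2]; exact ht5
        rw [Real.exp_lt_exp] at this
        linarith
      have h5 : s2 ^ (-(1 / γ)) < s ^ (-(1 / γ)) :=
        Real.rpow_lt_rpow_of_neg hs hss (by rw [neg_lt_zero]; positivity)
      have := aux_gt hγ hs2 (h5.trans_le hc)
      linarith
    have h6 := (aux_exp s).eventually (gt_mem_nhds (show Real.exp (-s) < t by rw [hst]; exact ht3))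
    filter_upwards [h6, key s hs hx] with n h1 h2
    linarith

lemma aux_int {b : ℝ → ℝ} (hb : Tendsto b (𝓝[>] (0 : ℝ)) (𝓝 0)) {s : ℝ} (hs : 0 < s) :
    Tendsto (fun u => ∫ t in (s * u)..u, b t / t) (𝓝[>] (0 : ℝ)) (𝓝 0) := by
  rw [Metric.tendsto_nhds]
  intro ε hε
  set m := min s 1 with hm
  have hm0 : 0 < m := lt_min hs one_pos
  set C := |1 - s| / m with hC
  have hC0 : 0 ≤ C := by positivity
  obtain ⟨δ, hδ, hδC⟩ : ∃ δ : ℝ, 0 < δ ∧ δ * C < ε := by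
    refine ⟨ε / (C + 1), by positivity, ?_⟩
    rw [div_mul_eq_mul_div, div_lt_iff₀ (by positivity)]
    nlinarith
  have h1 : ∀ᶠ t in 𝓝[>] (0 : ℝ), |b t| < δ := by
    have := (Metric.tendsto_nhds.1 hb) δ hδ
    simpa [Real.dist_eq] using this
  rw [eventually_nhdsWithin_iff, Metric.eventually_nhds_iff] at h1
  obtain ⟨η, hη, h1⟩ := h1
  have h2 : ∀ᶠ u in 𝓝[>] (0 : ℝ), u < η / (max s 1) := by
    apply eventually_nhdsWithin_of_eventually_nhds
    exact gt_mem_nhds (by positivity)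
  filter_upwards [h2, self_mem_nhdsWithin] with u hu hu0
  have hu0' : 0 < u := hu0
  rw [Real.dist_eq, sub_zero]
  have h3 : ‖∫ t in (s * u)..u, b t / t‖ ≤ (δ / (m * u)) * |u - s * u| := by
    apply intervalIntegral.norm_integral_le_of_norm_le_const
    intro t ht
    rw [uIoc, mem_Ioc] at ht
    have hmt : m * u < t := by
      refine lt_of_le_of_lt ?_ ht.1
      rw [hm, min_mul_of_nonneg _ _ hu0'.le, one_mul]
    have htM : t < η := by
      have : t ≤ max s 1 * u := by
        refine ht.2.trans ?_
        rw [max_mul_of_nonneg _ _ hu0'.le, one_mul]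
      rw [lt_div_iff₀ (by positivity)] at hu
      linarith
    have hmu : 0 < m * u := by positivity
    have ht0 : 0 < t := hmu.trans hmt
    have hbt := h1 (y := t) (by rw [Real.dist_eq, sub_zero, abs_of_pos ht0]; exact htM) ht0
    rw [Real.norm_eq_abs, abs_div, abs_of_pos ht0]
    gcongr
  have h4 : (δ / (m * u)) * |u - s * u| = δ * C := by
    rw [show u - s * u = u * (1 - s) by ring, abs_mul, abs_of_pos hu0', hC]
    field_simp
  rw [h4] at h3
  exact h3.trans_lt hδC

lemma aux_inv_tendsto {s : ℝ} (hs : 0 < s) :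
    Tendsto (fun n : ℕ => s / (n : ℝ)) atTop (𝓝[>] (0 : ℝ)) := by
  rw [tendsto_nhdsWithin_iff]
  refine ⟨tendsto_const_div_atTop_nhds_zero_nat s, ?_⟩
  filter_upwards [eventually_gt_atTop 0] with n hn
  have : (0 : ℝ) < n := by exact_mod_cast hn
  exact div_pos hs this

lemma aux_backward {F : ℝ → ℝ} (hF : IsDF F) {γ : ℝ} (hγ : 0 < γ) {c : ℝ} (hc : 0 < c)
    {f b : ℝ → ℝ} (hf : Tendsto f (𝓝[>] (0 : ℝ)) (𝓝 0)) (hb : Tendsto b (𝓝[>] (0 : ℝ)) (𝓝 0))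
    (hint : ∀ u ∈ Set.Ioo (0 : ℝ) 1, IntegrableOn (fun t => b t / t) (Set.Ioc u 1))
    (hQ : ∀ u ∈ Set.Ioo (0 : ℝ) 1,
          genInv F (1 - u) =
            c * (1 + f u) * u ^ (-(1 / γ)) * Real.exp (∫ t in u..1, b t / t)) :
    MemDomAttr F (frechetDF γ) := by
  classical
  set a : ℕ → ℝ := fun n => if 0 < genInv F (1 - 1 / n) then genInv F (1 - 1 / n) else 1 with haD
  have ha : ∀ n, 0 < a n := by
    intro n
    simp only [haD]
    split_ifs with h
    · exact h
    · exact one_pos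
  refine ⟨a, fun _ => 0, ha, fun x _ => ?_⟩
  simp only [add_zero]
  refine aux_conv hF hγ ha ?_ x
  intro s hs
  have hs1 := aux_inv_tendsto hs
  have h11 := aux_inv_tendsto one_pos
  have hIoo : Ioo (0 : ℝ) 1 ∈ 𝓝[>] (0 : ℝ) := Ioo_mem_nhdsGT one_pos
  have hlim : Tendsto (fun n : ℕ => (1 + f (s / n)) / (1 + f (1 / n)) * s ^ (-(1 / γ)) *
      Real.exp (∫ t in (s * (1 / n))..(1 / n : ℝ), b t / t)) atTop (𝓝 (s ^ (-(1 / γ)))) := by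
    have e1 : Tendsto (fun n : ℕ => 1 + f (s / n)) atTop (𝓝 (1 + 0)) :=
      tendsto_const_nhds.add (hf.comp hs1)
    have e2 : Tendsto (fun n : ℕ => 1 + f (1 / n)) atTop (𝓝 (1 + 0)) :=
      tendsto_const_nhds.add (hf.comp h11)
    have e3 := (aux_int hb hs).comp h11
    have e4 := (Real.continuous_exp.tendsto 0).comp e3
    have := ((e1.div e2 (by norm_num)).mul_const (s ^ (-(1 / γ)))).mul e4
    simpa using this
  refine hlim.congr' ?_
  have e2 : ∀ᶠ n : ℕ in atTop, -1 < f (1 / n) :=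
    (hf.comp h11).eventually (lt_mem_nhds (by norm_num))
  filter_upwards [hs1.eventually hIoo, h11.eventually hIoo, e2, eventually_gt_atTop 0]
    with n m1 m2 hpos hn
  have hn' : (0 : ℝ) < n := by exact_mod_cast hn
  have q1 := hQ _ m1
  have q2 := hQ _ m2
  have hfp : 0 < 1 + f (1 / n) := by linarith
  have h1n : (0 : ℝ) < 1 / n := m2.1
  have hQpos : 0 < genInv F (1 - 1 / n) := by
    rw [q2]
    positivity
  have han : a n = genInv F (1 - 1 / n) := by simp only [haD, if_pos hQpos]
  have i1 : IntervalIntegrable (fun t => b t / t) volume (s / n) 1 :=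
    (intervalIntegrable_iff_integrableOn_Ioc_of_le m1.2.le).2 (hint _ m1)
  have i2 : IntervalIntegrable (fun t => b t / t) volume (1 / n) 1 :=
    (intervalIntegrable_iff_integrableOn_Ioc_of_le m2.2.le).2 (hint _ m2)
  have hadd := intervalIntegral.integral_add_adjacent_intervals (i1.trans i2.symm) i2
  have hsn : s * (1 / n) = s / n := by ring
  rw [han, q1, q2, ← hadd, Real.exp_add, hsn, ← hsn, Real.mul_rpow hs.le h1n.le]
  have p1 : (0 : ℝ) < (1 / n : ℝ) ^ (-(1 / γ)) := Real.rpow_pos_of_pos h1n _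
  have p2 := Real.exp_pos (∫ t in (1 / n : ℝ)..1, b t / t)
  field_simp

lemma aux_contr {z e : ℕ → ℝ} {q : ℝ} (hq0 : 0 ≤ q) (hq : q < 1) (he : Tendsto e atTop (𝓝 0))
    (hz : ∀ k, 0 ≤ z k) (h : ∀ᶠ k in atTop, z (k + 1) ≤ q * z k + e k) :
    Tendsto z atTop (𝓝 0) := by
  rw [tendsto_order]
  refine ⟨fun a ha => Eventually.of_forall fun k => ha.trans_le (hz k), fun ε hε => ?_⟩
  have h1 : ∀ᶠ k in atTop, e k < (1 - q) * (ε / 2) :=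
    he.eventually (gt_mem_nhds (by have : 0 < 1 - q := by linarith
                                   positivity))
  obtain ⟨N, hN⟩ := eventually_atTop.1 (h.and h1)
  have h2 : ∀ m, z (N + m) ≤ ε / 2 + q ^ m * z N := by
    intro m
    induction m with
    | zero => simp; linarith
    | succ m ih =>
      have h3 := hN (N + m) (by omega)
      have h4 := mul_le_mul_of_nonneg_left ih hq0
      rw [← add_assoc, pow_succ]
      nlinarith
  have h5 : Tendsto (fun m => q ^ m * z N) atTop (𝓝 (0 * z N)) :=
    (tendsto_pow_atTop_nhds_zero_of_lt_one hq0 hq).mul_const _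
  rw [zero_mul] at h5
  obtain ⟨M, hM⟩ := eventually_atTop.1 (h5.eventually (gt_mem_nhds (show (0 : ℝ) < ε / 2 by positivity)))
  filter_upwards [eventually_ge_atTop (N + M)] with k hk
  obtain ⟨m, rfl⟩ := Nat.exists_eq_add_of_le (show N ≤ k by omega)
  have := h2 m
  have := hM m (by omega)
  linarith

lemma aux_affine {x d q : ℕ → ℝ} {d0 q0 x0 : ℝ} (hd : Tendsto d atTop (𝓝 d0))
    (hq : Tendsto q atTop (𝓝 q0)) (h0 : 0 < q0) (h1 : q0 < 1)
    (hx : ∀ k, x (k + 1) = (x k + d k) * q k) (hx0 : x0 = (x0 + d0) * q0) :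
    Tendsto x atTop (𝓝 x0) := by
  obtain ⟨q1, hq1, hq2⟩ := exists_between h1
  have he : Tendsto (fun k => |(x0 + d k) * q k - x0|) atTop (𝓝 0) := by
    have h3 : Tendsto (fun k => (x0 + d k) * q k - x0) atTop (𝓝 ((x0 + d0) * q0 - x0)) :=
      ((tendsto_const_nhds.add hd).mul hq).sub tendsto_const_nhds
    rw [← hx0, sub_self] at h3
    simpa using h3.abs
  have hz : Tendsto (fun k => |x k - x0|) atTop (𝓝 0) := by
    refine aux_contr (by linarith : 0 ≤ q1) hq2 he (fun k => abs_nonneg _) ?_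
    filter_upwards [hq.eventually (gt_mem_nhds hq1), hq.eventually (lt_mem_nhds h0)] with k h5 h6
    rw [hx]
    calc |(x k + d k) * q k - x0| = |q k * (x k - x0) + ((x0 + d k) * q k - x0)| := by
          congr 1; ring
      _ ≤ |q k * (x k - x0)| + |(x0 + d k) * q k - x0| := abs_add_le _ _
      _ ≤ _ := by
          rw [abs_mul, abs_of_pos h6]
          gcongr
  rw [tendsto_iff_dist_tendsto_zero]
  simpa [Real.dist_eq] using hz

lemma aux_reg {F : ℝ → ℝ} (hF : IsDF F) {γ : ℝ} (hγ : 0 < γ) (h : MemDomAttr F (frechetDF γ)) :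
    (∀ᶠ k : ℕ in atTop, 0 < genInv F (1 - 1 / 2 ^ k)) ∧
    ∀ s : ℝ, 0 < s → Tendsto (fun k : ℕ => genInv F (1 - s / 2 ^ k) / genInv F (1 - 1 / 2 ^ k))
      atTop (𝓝 (s ^ (-(1 / γ)))) := by
  obtain ⟨a, b, ha, hab⟩ := h
  have hq : ∀ s : ℝ, 0 < s → Tendsto (fun k : ℕ => (genInv F (1 - s / 2 ^ k) - b (2 ^ k)) / a (2 ^ k))
      atTop (𝓝 (s ^ (-(1 / γ)))) := by
    intro s hs
    have h1 := aux_quant hF hγ ha (fun x => hab x (aux_cont hγ x)) hs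
    have h2 := h1.comp (tendsto_pow_atTop_atTop_of_one_lt (show 1 < 2 by norm_num))
    refine h2.congr fun k => ?_
    simp
  set ρ := 1 / γ with hρ
  have hρ0 : 0 < ρ := by positivity
  set r : ℝ := 2 ^ ρ with hr
  have hr1 : 1 < r := Real.one_lt_rpow (by norm_num) hρ0
  have e1 : Tendsto (fun k : ℕ => (genInv F (1 - 1 / 2 ^ k) - b (2 ^ k)) / a (2 ^ k)) atTop (𝓝 1) := by
    simpa using hq 1 one_pos
  have e2 : Tendsto (fun k : ℕ => (genInv F (1 - 2 / 2 ^ k) - b (2 ^ k)) / a (2 ^ k)) atTop (𝓝 r⁻¹) := by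
    have := hq 2 two_pos
    rwa [Real.rpow_neg (by norm_num)] at this
  have e3 : Tendsto (fun k : ℕ => (genInv F (1 - (1 / 2) / 2 ^ k) - b (2 ^ k)) / a (2 ^ k)) atTop (𝓝 r) := by
    have := hq (1 / 2) (by norm_num)
    rwa [one_div, Real.inv_rpow (by norm_num), Real.rpow_neg (by norm_num), inv_inv, ← one_div] at this
  set A : ℕ → ℝ := fun k => genInv F (1 - 1 / 2 ^ k) with hA
  -- increments
  have d1 : Tendsto (fun k => (A (k + 1) - A k) / a (2 ^ k)) atTop (𝓝 (r - 1)) := by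
    refine (e3.sub e1).congr fun k => ?_
    simp only [hA]
    rw [show (1 / 2 : ℝ) / 2 ^ k = 1 / 2 ^ (k + 1) by rw [pow_succ]; field_simp]
    ring
  have d2 : Tendsto (fun k => (A (k + 1) - A k) / a (2 ^ (k + 1))) atTop (𝓝 (1 - r⁻¹)) := by
    refine ((e1.sub e2).comp (tendsto_add_atTop_nat 1)).congr fun k => ?_
    simp only [hA, Function.comp]
    rw [show (2 : ℝ) / 2 ^ (k + 1) = 1 / 2 ^ k by rw [pow_succ]; field_simp]
    ring
  have hrr : 0 < r⁻¹ := by positivity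
  have hrr1 : r⁻¹ < 1 := inv_lt_one_of_one_lt₀ hr1
  have d3 : Tendsto (fun k => a (2 ^ k) / a (2 ^ (k + 1))) atTop (𝓝 r⁻¹) := by
    have h1 := d2.div d1 (by linarith)
    have h2 : (1 - r⁻¹) / (r - 1) = r⁻¹ := by
      have : r - 1 ≠ 0 := by linarith
      have : r ≠ 0 := by linarith
      field_simp
    rw [h2] at h1
    refine h1.congr' ?_
    filter_upwards [d1.eventually (lt_mem_nhds (show 0 < r - 1 by linarith))] with k hk
    have h3 := ha (2 ^ k)
    have h4 := ha (2 ^ (k + 1))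
    have h5 : A (k + 1) - A k ≠ 0 := by
      intro h0
      rw [h0] at hk
      simp at hk
    simp only [Pi.div_apply]
    field_simp
  have hx : Tendsto (fun k => A k / a (2 ^ k)) atTop (𝓝 1) := by
    refine aux_affine d1 d3 hrr hrr1 (fun k => ?_) ?_
    · have h3 := (ha (2 ^ k)).ne'
      have h4 := (ha (2 ^ (k + 1))).ne'
      field_simp
      ring
    · have : r ≠ 0 := by linarith
      field_simp
      ring
  refine ⟨?_, fun s hs => ?_⟩
  · filter_upwards [hx.eventually (lt_mem_nhds one_pos)] with k hk
    have := mul_pos hk (ha (2 ^ k))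
    rwa [div_mul_cancel₀ _ (ha _).ne'] at this
  · have h1 := ((hq s hs).sub (e1.sub hx)).div hx one_ne_zero
    simp only [sub_self, sub_zero, div_one] at h1
    refine h1.congr fun k => ?_
    have h3 := (ha (2 ^ k)).ne'
    simp only [Pi.div_apply, hA]
    by_cases h0 : genInv F (1 - 1 / 2 ^ k) = 0
    · rw [h0]
      simp
    · field_simp
      ring

/-- sandwich -/
lemma aux_unif {F : ℝ → ℝ} (hF : IsDF F) {ρ : ℝ}
    (hpos : ∀ᶠ k : ℕ in atTop, 0 < genInv F (1 - 1 / 2 ^ k))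
    (hreg : ∀ s : ℝ, 0 < s →
      Tendsto (fun k : ℕ => genInv F (1 - s / 2 ^ k) / genInv F (1 - 1 / 2 ^ k))
      atTop (𝓝 (s ^ (-ρ)))) {ι : Type} {l : Filter ι} {k : ι → ℕ} {s : ι → ℝ} {s0 : ℝ}
    (hs0 : 0 < s0) (hk : Tendsto k l atTop) (hs : Tendsto s l (𝓝 s0)) :
    Tendsto (fun i => genInv F (1 - s i / 2 ^ k i) / genInv F (1 - 1 / 2 ^ k i)) l
      (𝓝 (s0 ^ (-ρ))) := by
  have hcont : ContinuousAt (fun x : ℝ => x ^ (-ρ)) s0 :=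
    Real.continuousAt_rpow_const _ _ (Or.inl hs0.ne')
  have hsmall : ∀ t : ℝ, ∀ᶠ i in l, t / 2 ^ k i < 1 := by
    intro t
    have h1 : Tendsto (fun n : ℕ => t / (2 : ℝ) ^ n) atTop (𝓝 0) :=
      tendsto_const_nhds.div_atTop (tendsto_pow_atTop_atTop_of_one_lt (by norm_num))
    exact (h1.comp hk).eventually (gt_mem_nhds one_pos)
  rw [tendsto_order]
  constructor
  · intro c hc
    have h1 : ∀ᶠ x in 𝓝[>] s0, c < x ^ (-ρ) :=
      eventually_nhdsWithin_of_eventually_nhds (hcont.eventually (lt_mem_nhds hc))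
    obtain ⟨s1, h2, h3⟩ := (h1.and self_mem_nhdsWithin).exists
    have h3' : s0 < s1 := h3
    filter_upwards [hk.eventually ((hreg s1 (hs0.trans h3')).eventually (lt_mem_nhds h2)),
      hs.eventually (gt_mem_nhds h3'), hs.eventually (lt_mem_nhds hs0), hsmall s1,
      hk.eventually hpos] with i q1 q2 q3 q4 q5
    refine q1.trans_le ?_
    gcongr
    exact aux_anti hF (by positivity) (by gcongr) q4
  · intro c hc
    have h1 : ∀ᶠ x in 𝓝[<] s0, x ^ (-ρ) < c :=
      eventually_nhdsWithin_of_eventually_nhds (hcont.eventually (gt_mem_nhds hc))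
    have h1' : ∀ᶠ x in 𝓝[<] s0, 0 < x :=
      eventually_nhdsWithin_of_eventually_nhds (lt_mem_nhds hs0)
    obtain ⟨s1, ⟨h2, h4⟩, h3⟩ := ((h1.and h1').and self_mem_nhdsWithin).exists
    have h3' : s1 < s0 := h3
    filter_upwards [hk.eventually ((hreg s1 h4).eventually (gt_mem_nhds h2)),
      hs.eventually (lt_mem_nhds h3'), hs.eventually (gt_mem_nhds (lt_add_one s0)),
      hsmall (s0 + 1), hk.eventually hpos] with i q1 q2 q3 q4 q5
    refine lt_of_le_of_lt ?_ q1
    gcongr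
    refine aux_anti hF (by positivity) (by gcongr) (lt_of_le_of_lt ?_ q4)
    gcongr

def auxK (u : ℝ) : ℕ := ⌊-Real.logb 2 u⌋₊

lemma auxK_meas : Measurable auxK := by
  unfold auxK
  refine Nat.measurable_floor.comp ?_
  unfold Real.logb
  exact (Real.measurable_log.div_const _).neg

lemma auxK_tendsto : Tendsto auxK (𝓝[>] (0 : ℝ)) atTop := by
  unfold auxK
  refine tendsto_nat_floor_atTop.comp (tendsto_neg_atBot_atTop.comp ?_)
  exact Real.tendsto_logb_nhdsGT_zero (by norm_num)

lemma auxK_spec {u : ℝ} (h0 : 0 < u) (h1 : u ≤ 1) :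
    1 / 2 ^ (auxK u + 1) < u ∧ u ≤ 1 / 2 ^ auxK u := by
  have hl : 0 ≤ -Real.logb 2 u := by
    have := Real.logb_nonpos (b := 2) (by norm_num) h0.le h1
    linarith
  have h2 := Nat.floor_le hl
  have h3 := Nat.lt_floor_add_one (-Real.logb 2 u)
  have key : ∀ n : ℕ, (1 : ℝ) / 2 ^ n = 2 ^ (-(n : ℝ)) := by
    intro n
    rw [Real.rpow_neg (by norm_num), Real.rpow_natCast, one_div]
  rw [key, key]
  constructor
  · rw [← Real.lt_logb_iff_rpow_lt (by norm_num) h0]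
    unfold auxK
    push_cast
    linarith
  · rw [← Real.logb_le_iff_le_rpow (by norm_num) h0]
    unfold auxK
    linarith

lemma auxK_eq {u : ℝ} {k : ℕ} (h1 : 1 / 2 ^ (k + 1) < u) (h2 : u ≤ 1 / 2 ^ k) : auxK u = k := by
  have h0 : 0 < u := lt_trans (by positivity) h1
  have key : ∀ n : ℕ, (1 : ℝ) / 2 ^ n = 2 ^ (-(n : ℝ)) := by
    intro n
    rw [Real.rpow_neg (by norm_num), Real.rpow_natCast, one_div]
  rw [key, ← Real.lt_logb_iff_rpow_lt (by norm_num) h0] at h1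
  rw [key, ← Real.logb_le_iff_le_rpow (by norm_num) h0] at h2
  push_cast at h1
  unfold auxK
  rw [Nat.floor_eq_iff]
  · constructor <;> linarith
  · have : (0 : ℝ) ≤ k := by positivity
    linarith

lemma aux_piece (B : ℕ → ℝ) {k : ℕ} {u v : ℝ} (h1 : 1 / 2 ^ (k + 1) ≤ u) (huv : u ≤ v)
    (h2 : v ≤ 1 / 2 ^ k) :
    IntervalIntegrable (fun t => B (auxK t) / t) volume u v ∧
      ∫ t in u..v, B (auxK t) / t = B k * Real.log (v / u) := by
  have h0 : 0 < u := lt_of_lt_of_le (by positivity) h1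
  have heq : EqOn (fun t => B k * (1 / t)) (fun t => B (auxK t) / t) (uIoc u v) := by
    intro t ht
    rw [uIoc_of_le huv] at ht
    simp only
    rw [auxK_eq (h1.trans_lt ht.1) (ht.2.trans h2)]
    ring
  have hi : IntervalIntegrable (fun t : ℝ => B k * (1 / t)) volume u v := by
    refine IntervalIntegrable.const_mul ?_ _
    refine intervalIntegral.intervalIntegrable_one_div (f := fun t => t) ?_ continuousOn_id
    intro x hx
    rw [uIcc_of_le huv] at hx
    exact (h0.trans_le hx.1).ne'
  refine ⟨hi.congr heq, ?_⟩
  rw [← intervalIntegral.integral_congr_ae (Eventually.of_forall fun t ht => heq ht),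
    intervalIntegral.integral_const_mul, integral_one_div_of_pos h0 (h0.trans_le huv)]

lemma aux_total (B : ℕ → ℝ) (k : ℕ) :
    IntervalIntegrable (fun t => B (auxK t) / t) volume (1 / 2 ^ k) 1 ∧
      ∫ t in (1 / 2 ^ k)..1, B (auxK t) / t = (∑ i ∈ Finset.range k, B i) * Real.log 2 := by
  induction k with
  | zero => simp
  | succ k ih =>
    have hle : (1 : ℝ) / 2 ^ (k + 1) ≤ 1 / 2 ^ k :=
      one_div_le_one_div_of_le (by positivity) (pow_le_pow_right₀ (by norm_num) (by omega))
    obtain ⟨p1, p2⟩ := aux_piece B le_rfl hle le_rfl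
    refine ⟨p1.trans ih.1, ?_⟩
    rw [← intervalIntegral.integral_add_adjacent_intervals p1 ih.1, p2, ih.2,
      Finset.sum_range_succ]
    have : (1 : ℝ) / 2 ^ k / (1 / 2 ^ (k + 1)) = 2 := by
      rw [pow_succ]
      field_simp
    rw [this]
    ring

lemma aux_Qmeas {F : ℝ → ℝ} (hF : IsDF F) :
    Measurable (fun u => (Ioo (0 : ℝ) 1).indicator (fun u => genInv F (1 - u)) u) := by
  refine measurable_of_Iic fun y => ?_
  have : (fun u => (Ioo (0 : ℝ) 1).indicator (fun u => genInv F (1 - u)) u) ⁻¹' Iic y =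
      (Ioo 0 1 ∩ Ici (1 - F y)) ∪ ((Ioo 0 1)ᶜ ∩ {_u | 0 ≤ y}) := by
    ext u
    by_cases hu : u ∈ Ioo (0 : ℝ) 1
    · have h1 := aux_galois hF (p := 1 - u) (by linarith [hu.2]) (by linarith [hu.1]) y
      simp only [mem_preimage, indicator_of_mem hu, mem_Iic, mem_union, mem_inter_iff, hu,
        mem_Ici, true_and, mem_compl_iff, not_true, false_and, or_false, h1]
      constructor <;> intro <;> linarith
    · simp [hu]
  rw [this]
  exact (measurableSet_Ioo.inter measurableSet_Ici).union
    (measurableSet_Ioo.compl.inter (MeasurableSet.const _))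

lemma aux_forward {F : ℝ → ℝ} (hF : IsDF F) {γ : ℝ} (hγ : 0 < γ)
    (h : MemDomAttr F (frechetDF γ)) :
      ∃ c : ℝ, 0 < c ∧ ∃ f b : ℝ → ℝ, Measurable f ∧ Measurable b ∧
        Tendsto f (𝓝[>] (0 : ℝ)) (𝓝 0) ∧ Tendsto b (𝓝[>] (0 : ℝ)) (𝓝 0) ∧
        (∀ u ∈ Set.Ioo (0 : ℝ) 1, IntegrableOn (fun t => b t / t) (Set.Ioc u 1)) ∧
        (∀ u ∈ Set.Ioo (0 : ℝ) 1,
          genInv F (1 - u) =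
            c * (1 + f u) * u ^ (-(1 / γ)) * Real.exp (∫ t in u..1, b t / t)) := by
  classical
  obtain ⟨hpos, hreg⟩ := aux_reg hF hγ h
  set ρ := 1 / γ with hρ
  set A : ℕ → ℝ := fun k => if 0 < genInv F (1 - 1 / 2 ^ k) then genInv F (1 - 1 / 2 ^ k) else 1
    with hA
  have hA0 : ∀ k, 0 < A k := by
    intro k
    simp only [hA]
    split_ifs with h
    · exact h
    · exact one_pos
  have hAe : ∀ᶠ k in atTop, A k = genInv F (1 - 1 / 2 ^ k) := by
    filter_upwards [hpos] with k hk
    simp only [hA, if_pos hk]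
  have hl2 : 0 < Real.log 2 := Real.log_pos (by norm_num)
  set B : ℕ → ℝ := fun k => (Real.log (A (k + 1)) - Real.log (A k)) / Real.log 2 - ρ with hB
  have hBlim : Tendsto B atTop (𝓝 0) := by
    have h1 := hreg (1 / 2) (by norm_num)
    have h2 : ((1 : ℝ) / 2) ^ (-ρ) = 2 ^ ρ := by
      rw [one_div, Real.inv_rpow (by norm_num), Real.rpow_neg (by norm_num), inv_inv]
    rw [h2] at h1
    have h3 := h1.log (by positivity)
    rw [Real.log_rpow two_pos] at h3
    have h4 := (h3.div_const (Real.log 2)).sub_const ρ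
    rw [mul_div_cancel_right₀ _ hl2.ne', sub_self] at h4
    refine h4.congr' ?_
    filter_upwards [hAe, (tendsto_add_atTop_nat 1).eventually hAe] with k e1 e2
    simp only [hB]
    rw [← Real.log_div (hA0 _).ne' (hA0 _).ne', e1, e2]
    rw [show (1 / 2 : ℝ) / 2 ^ k = 1 / 2 ^ (k + 1) by rw [pow_succ]; field_simp]
  have hBsum : ∀ k, (∑ i ∈ Finset.range k, B i) * Real.log 2 =
      Real.log (A k) - Real.log (A 0) - ρ * k * Real.log 2 := by
    intro k
    induction k with
    | zero => simp
    | succ k ih =>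
      rw [Finset.sum_range_succ, add_mul, ih]
      simp only [hB]
      push_cast
      field_simp
      ring
  set S : ℝ → ℝ := fun u => u * 2 ^ auxK u with hS
  have hSmeas : Measurable S :=
    measurable_id.mul ((measurable_from_nat (f := fun k : ℕ => (2 : ℝ) ^ k)).comp auxK_meas)
  set E : ℝ → ℝ := fun u => A (auxK u) * S u ^ (-ρ - B (auxK u)) with hE
  have hBmeas : Measurable (fun t => B (auxK t)) := (measurable_from_nat (f := B)).comp auxK_meas
  have hEmeas : Measurable E :=
    ((measurable_from_nat (f := A)).comp auxK_meas).mul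
      (hSmeas.pow ((measurable_const (a := -ρ)).sub hBmeas))
  have hSspec : ∀ u, 0 < u → u ≤ 1 → 1 / 2 < S u ∧ S u ≤ 1 := by
    intro u h0 h1
    obtain ⟨h2, h3⟩ := auxK_spec h0 h1
    simp only [hS]
    have hp : (0 : ℝ) < 2 ^ auxK u := by positivity
    constructor
    · rw [div_lt_iff₀ (by positivity), pow_succ] at h2
      linarith
    · rwa [le_div_iff₀ hp] at h3
  have hint : ∀ u ∈ Ioo (0 : ℝ) 1,
      IntervalIntegrable (fun t => B (auxK t) / t) volume u 1 ∧
      A 0 * u ^ (-ρ) * Real.exp (∫ t in u..1, B (auxK t) / t) = E u := by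
    intro u hu
    obtain ⟨h2, h3⟩ := auxK_spec hu.1 hu.2.le
    obtain ⟨p1, p2⟩ := aux_piece B h2.le h3 le_rfl
    obtain ⟨t1, t2⟩ := aux_total B (auxK u)
    refine ⟨p1.trans t1, ?_⟩
    rw [← intervalIntegral.integral_add_adjacent_intervals p1 t1, p2, t2, hBsum]
    have hSu := (hSspec u hu.1 hu.2.le).1
    have hS0 : 0 < S u := by linarith
    have hp : (0 : ℝ) < 2 ^ auxK u := by positivity
    have hlS : Real.log (S u) = Real.log u + auxK u * Real.log 2 := by
      simp only [hS]
      rw [Real.log_mul hu.1.ne' hp.ne', Real.log_pow]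
    have hq : Real.log (1 / 2 ^ auxK u / u) = - Real.log (S u) := by
      rw [← Real.log_inv]
      congr 1
      simp only [hS]
      field_simp
    rw [hq]
    simp only [hE]
    rw [Real.rpow_def_of_pos hS0, Real.rpow_def_of_pos hu.1]
    conv_lhs => rw [← Real.exp_log (hA0 0)]
    conv_rhs => rw [← Real.exp_log (hA0 (auxK u))]
    rw [← Real.exp_add, ← Real.exp_add, ← Real.exp_add]
    congr 1
    rw [Real.log_exp, hlS]
    ring
  have hE0 : ∀ u ∈ Ioo (0 : ℝ) 1, 0 < E u := by
    intro u hu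
    have hSu := (hSspec u hu.1 hu.2.le).1
    have hS0 : 0 < S u := by linarith
    exact mul_pos (hA0 _) (Real.rpow_pos_of_pos hS0 _)
  refine ⟨A 0, hA0 0,
    fun u => (Ioo (0 : ℝ) 1).indicator (fun u => genInv F (1 - u)) u / E u - 1,
    fun t => B (auxK t), ((aux_Qmeas hF).div hEmeas).sub_const 1,
    hBmeas, ?_, hBlim.comp auxK_tendsto, ?_, ?_⟩
  · rw [tendsto_iff_ultrafilter]
    intro g hg
    have hgIoo : Ioo (0 : ℝ) 1 ∈ (g : Filter ℝ) := hg (Ioo_mem_nhdsGT one_pos)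
    have hK : Tendsto auxK g atTop := auxK_tendsto.mono_left hg
    obtain ⟨s0, hs0, hlim⟩ := (isCompact_Icc (a := (1 / 2 : ℝ)) (b := 1)).ultrafilter_le_nhds
      (g.map S) (by
        rw [le_principal_iff]
        change S ⁻¹' _ ∈ (g : Filter ℝ)
        filter_upwards [hgIoo] with u hu
        have := hSspec u hu.1 hu.2.le
        exact ⟨this.1.le, this.2⟩)
    have hSl : Tendsto S g (𝓝 s0) := hlim
    have hs0p : 0 < s0 := by linarith [hs0.1]
    have h1 := aux_unif hF hpos hreg hs0p hK hSl
    have h2 : Tendsto (fun u => S u ^ (-ρ - B (auxK u))) g (𝓝 (s0 ^ (-ρ - 0))) :=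
      hSl.rpow (tendsto_const_nhds.sub (hBlim.comp hK)) (Or.inl hs0p.ne')
    rw [sub_zero] at h2
    have hsp : s0 ^ (-ρ) ≠ 0 := (Real.rpow_pos_of_pos hs0p _).ne'
    have h3 := (h1.div h2 hsp).sub_const 1
    rw [div_self hsp, sub_self] at h3
    refine h3.congr' ?_
    filter_upwards [hgIoo, hK.eventually hAe] with u hu hAu
    rw [indicator_of_mem hu]
    simp only [Pi.div_apply, hE]
    rw [← hAu, div_div]
    congr 5
    simp only [hS]
    field_simp
  · intro u hu
    exact (intervalIntegrable_iff_integrableOn_Ioc_of_le hu.2.le).1 (hint u hu).1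
  · intro u hu
    have h1 := (hint u hu).2
    have h2 := hE0 u hu
    simp only [indicator_of_mem hu]
    rw [show A 0 * (1 + (genInv F (1 - u) / E u - 1)) * u ^ (-ρ) *
      Real.exp (∫ t in u..1, B (auxK t) / t) = (genInv F (1 - u) / E u) *
      (A 0 * u ^ (-ρ) * Real.exp (∫ t in u..1, B (auxK t) / t)) by ring, h1,
      div_mul_cancel₀ _ h2.ne']

/-- Karamata representation for the Fréchet domain. -/
theorem frechet_karamata_representation (F : ℝ → ℝ) (hF : IsDF F) (γ : ℝ) (hγ : 0 < γ) :
    MemDomAttr F (frechetDF γ) ↔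
      ∃ c : ℝ, 0 < c ∧ ∃ f b : ℝ → ℝ, Measurable f ∧ Measurable b ∧
        Tendsto f (𝓝[>] (0 : ℝ)) (𝓝 0) ∧ Tendsto b (𝓝[>] (0 : ℝ)) (𝓝 0) ∧
        (∀ u ∈ Set.Ioo (0 : ℝ) 1, IntegrableOn (fun t => b t / t) (Set.Ioc u 1)) ∧
        (∀ u ∈ Set.Ioo (0 : ℝ) 1,
          genInv F (1 - u) =
            c * (1 + f u) * u ^ (-(1 / γ)) * Real.exp (∫ t in u..1, b t / t)) := by
  constructor
  · exact aux_forward hF hγ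
  · rintro ⟨c, hc, f, b, -, -, hf, hb, hint, hQ⟩
    exact aux_backward hF hγ hc hf hb hint hQ

end
end

section
/- If F is a distribution function with F(1) = 0 lying in Γ, and G(x) = F(e^x), then (1 − G(G⁻¹(1 − u)))/u → 1 as u → 0+. -/
open MeasureTheory Filter Topology Set

noncomputable section

theorem aux_tail (f : ℕ → ℝ) (hf1 : ∀ n, f n ≤ 1) (t : ℝ)
    (h : Tendsto (fun n => f n ^ n) atTop (𝓝 (Real.exp (-t)))) (h0 : ∀ n, 0 ≤ f n) :
    Tendsto (fun n : ℕ => (n : ℝ) * (1 - f n)) atTop (𝓝 t) := by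
  have hpos : ∀ᶠ n in atTop, 0 < f n := by
    filter_upwards [h.eventually (lt_mem_nhds (Real.exp_pos (-t))), eventually_gt_atTop 0]
      with n hn hn0
    rcases (h0 n).lt_or_eq with h1 | h1
    · exact h1
    · rw [← h1, zero_pow (by omega)] at hn
      exact absurd hn (lt_irrefl _)
  have hlog : Tendsto (fun n : ℕ => (n : ℝ) * (-Real.log (f n))) atTop (𝓝 t) := by
    have := (((Real.continuousAt_log (Real.exp_pos (-t)).ne').tendsto.comp h)).neg
    simp only [Real.log_exp, neg_neg] at this
    refine this.congr fun n => ?_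
    simp [Real.log_pow]
  have hlog0 : Tendsto (fun n : ℕ => Real.log (f n)) atTop (𝓝 0) := by
    have := (hlog.mul (tendsto_inv_atTop_nhds_zero_nat (𝕜 := ℝ))).neg
    simp only [mul_zero, neg_zero] at this
    refine this.congr' ?_
    filter_upwards [eventually_gt_atTop 0] with n hn
    have : (n : ℝ) ≠ 0 := by positivity
    field_simp
  have hf : Tendsto f atTop (𝓝 1) := by
    have := (Real.continuous_exp.tendsto 0).comp hlog0
    rw [Real.exp_zero] at this
    refine this.congr' ?_
    filter_upwards [hpos] with n hn
    simp [Real.exp_log hn]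
  have hlow := hlog.mul hf
  rw [mul_one] at hlow
  refine tendsto_of_tendsto_of_tendsto_of_le_of_le' hlow hlog ?_ ?_
  · filter_upwards [hpos] with n hn
    rw [mul_assoc]
    refine mul_le_mul_of_nonneg_left ?_ (Nat.cast_nonneg n)
    have h1 := Real.one_sub_inv_le_log_of_pos hn
    have h2 := mul_le_mul_of_nonneg_right h1 hn.le
    rw [sub_mul, inv_mul_cancel₀ hn.ne'] at h2
    linarith
  · filter_upwards [hpos] with n hn
    refine mul_le_mul_of_nonneg_left ?_ (Nat.cast_nonneg n)
    have := Real.log_le_sub_one_of_pos hn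
    linarith

theorem aux_attr (F M : ℝ → ℝ) (h : MemDomAttr F M) (t x : ℝ) (hx : ContinuousAt M x)
    (hM : M x = Real.exp (-t)) :
    ∃ y : ℕ → ℝ, Tendsto (fun n => F (y n) ^ n) atTop (𝓝 (Real.exp (-t))) := by
  obtain ⟨a, b, -, hab⟩ := h
  exact ⟨fun n => a n * x + b n, hM ▸ hab x hx⟩

theorem aux_gamma (F : ℝ → ℝ) (h : MemGamma F) (t : ℝ) (ht : 0 < t) :
    ∃ y : ℕ → ℝ, Tendsto (fun n => F (y n) ^ n) atTop (𝓝 (Real.exp (-t))) := by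
  rcases h with h | ⟨γ, hγ, h⟩ | ⟨γ, hγ, h⟩
  · refine aux_attr F _ h t (-Real.log t) ?_ ?_
    · have : Continuous gumbelDF := by unfold gumbelDF; fun_prop
      exact this.continuousAt
    · simp [gumbelDF, Real.exp_log ht]
  · have hp : 0 < t ^ (-γ⁻¹) := Real.rpow_pos_of_pos ht _
    refine aux_attr F _ h t (t ^ (-γ⁻¹)) ?_ ?_
    · have : ContinuousAt (fun x : ℝ => Real.exp (-(x ^ (-γ)))) (t ^ (-γ⁻¹)) :=
        (Real.continuousAt_rpow_const _ _ (Or.inl hp.ne')).neg.rexp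
      refine this.congr ?_
      filter_upwards [lt_mem_nhds hp] with x hx
      simp [frechetDF, hx]
    · rw [frechetDF, if_pos hp, ← Real.rpow_mul ht.le]
      simp [hγ.ne']
  · have hp : 0 < t ^ (γ⁻¹) := Real.rpow_pos_of_pos ht _
    refine aux_attr F _ h t (-t ^ (γ⁻¹)) ?_ ?_
    · have : ContinuousAt (fun x : ℝ => Real.exp (-((-x) ^ γ))) (-t ^ (γ⁻¹)) := by
        refine (ContinuousAt.rpow_const continuous_neg.continuousAt (Or.inl ?_)).neg.rexp
        simpa using hp.ne'
      refine this.congr ?_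
      filter_upwards [gt_mem_nhds (neg_lt_zero.2 hp)] with x hx
      simp [weibullDF, hx]
    · rw [weibullDF, if_pos (neg_lt_zero.2 hp), neg_neg, ← Real.rpow_mul ht.le]
      simp [hγ.ne']

/-- Lemma 3.2. -/
theorem one_sub_G_genInv_div_tendsto_one (F : ℝ → ℝ) (hF : IsDF F) (hF1 : F 1 = 0)
    (hΓ : MemGamma F) (G : ℝ → ℝ) (hG : G = fun x => F (Real.exp x)) :
    Tendsto (fun u => (1 - G (genInv G (1 - u))) / u) (𝓝[>] (0 : ℝ)) (𝓝 1) := by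
  obtain ⟨hmono, hrc, hbot, htop⟩ := hF
  have hle1 : ∀ x, F x ≤ 1 := fun x => hmono.ge_of_tendsto htop x
  have hge0 : ∀ x, 0 ≤ F x := fun x => hmono.le_of_tendsto hbot x
  have hGm : Monotone G := by
    rw [hG]; exact fun x y hxy => hmono (Real.exp_le_exp.2 hxy)
  have hGt : Tendsto G atTop (𝓝 1) := by
    rw [hG]; exact htop.comp Real.tendsto_exp_atTop
  have hGrc : ∀ x, ContinuousWithinAt G (Set.Ici x) x := by
    intro x
    rw [hG]
    exact ContinuousWithinAt.comp (t := Set.Ici (Real.exp x)) (hrc (Real.exp x))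
      Real.continuous_exp.continuousWithinAt (fun y hy => Real.exp_le_exp.2 hy)
  have hbdd : ∀ u < 1, BddBelow {x | 1 - u ≤ G x} := by
    intro u hu
    refine ⟨0, fun x hx => ?_⟩
    by_contra hlt
    push Not at hlt
    have h1 : G x ≤ 0 := by
      rw [hG, ← hF1]
      exact hmono (Real.exp_le_one_iff.2 hlt.le)
    have h2 : 1 - u ≤ G x := hx
    linarith
  have hne : ∀ u, 0 < u → {x | 1 - u ≤ G x}.Nonempty := by
    intro u hu
    obtain ⟨x, hx⟩ := (hGt.eventually (lt_mem_nhds (show 1 - u < 1 by linarith))).exists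
    exact ⟨x, le_of_lt hx⟩
  have hup : ∀ u, 0 < u → u < 1 → 1 - u ≤ G (genInv G (1 - u)) := by
    intro u hu hu1
    have hc : Tendsto G (𝓝[>] (genInv G (1 - u))) (𝓝 (G (genInv G (1 - u)))) :=
      (hGrc _).mono_left (nhdsWithin_mono _ Set.Ioi_subset_Ici_self)
    refine ge_of_tendsto hc ?_
    filter_upwards [self_mem_nhdsWithin] with x hx
    obtain ⟨z, hz, hzx⟩ := exists_lt_of_csInf_lt (hne u hu) hx
    exact le_trans hz (hGm hzx.le)
  have hinv : Tendsto (fun u : ℝ => u⁻¹) (𝓝[>] (0 : ℝ)) atTop := tendsto_inv_nhdsGT_zero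
  have hN : Tendsto (fun u : ℝ => ⌈u⁻¹⌉₊) (𝓝[>] (0 : ℝ)) atTop :=
    tendsto_nat_ceil_atTop.comp hinv
  have hNu : Tendsto (fun u : ℝ => (⌈u⁻¹⌉₊ : ℝ) / u⁻¹) (𝓝[>] (0 : ℝ)) (𝓝 1) :=
    (tendsto_nat_ceil_div_atTop (R := ℝ)).comp hinv
  have hu01 : ∀ᶠ u : ℝ in 𝓝[>] (0 : ℝ), 0 < u ∧ u < 1 :=
    Ioo_mem_nhdsGT one_pos
  rw [tendsto_order]
  constructor
  · intro c' hc'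
    obtain ⟨c, hc1, hc2⟩ := exists_between (max_lt hc' one_pos)
    have hc0 : 0 < c := lt_of_le_of_lt (le_max_right _ _) hc1
    have hcc : c' < c := lt_of_le_of_lt (le_max_left _ _) hc1
    obtain ⟨y, hy⟩ := aux_gamma F hΓ c hc0
    have ht := aux_tail (fun n => F (y n)) (fun n => hle1 _) c hy (fun n => hge0 _)
    have ht2 := (ht.comp hN).div hNu one_ne_zero
    rw [div_one] at ht2
    filter_upwards [hu01, ht2.eventually (lt_mem_nhds hcc), ht2.eventually (gt_mem_nhds hc2)]
      with u hu h1 h2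
    obtain ⟨hu0, hu1⟩ := hu
    set n := ⌈u⁻¹⌉₊ with hn
    have hn0 : (0 : ℝ) < n := by
      have : 0 < n := Nat.ceil_pos.2 (inv_pos.2 hu0)
      exact_mod_cast this
    have heq : ((fun n : ℕ => (n : ℝ) * (1 - F (y n))) ∘ fun u : ℝ => ⌈u⁻¹⌉₊) u / ((n : ℝ) / u⁻¹)
        = (1 - F (y n)) / u := by
      simp only [Function.comp]
      rw [← hn]
      field_simp
    simp only [Pi.div_apply] at h1 h2
    rw [heq] at h1 h2
    refine lt_of_lt_of_le h1 ?_
    rw [div_lt_one hu0] at h2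
    have hFp : 0 < F (y n) := by linarith
    have hy1 : 0 < y n := by
      by_contra hlt
      push Not at hlt
      have := hmono (show y n ≤ 1 by linarith)
      linarith
    have hGy : G (Real.log (y n)) = F (y n) := by
      rw [hG]; simp only [Real.exp_log hy1]
    have hq : genInv G (1 - u) ≤ Real.log (y n) :=
      csInf_le (hbdd u hu1) (show 1 - u ≤ G (Real.log (y n)) by rw [hGy]; linarith)
    have := hGm hq
    rw [hGy] at this
    gcongr
  · intro c hc
    filter_upwards [hu01] with u hu
    refine lt_of_le_of_lt ?_ hc
    rw [div_le_one hu.1]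
    have := hup u hu.1 hu.2
    linarith

end
end

section
/- Lemma 3.3(i): let G be a distribution function with G ∈ D(ψ_γ) for some γ > 0, and for r > 0 set G_r(x) = 1 − (1 − G(x))^r. Then G_r ∈ D(ψ_{rγ}), the upper endpoints coincide: x₀(G) = x₀(G_r) =: y₀, and R_1(x, z, G)/R_1(x, z, G_r) → (rγ + 1)/(γ + 1) as x → y₀ and z → y₀ with (1 − G(z))/(1 − G(x)) → 0. -/
open MeasureTheory Filter Topology Set

noncomputable section

lemma wpt_cc {ι : Type*} {L : Filter ι} (f : ι → ℝ → ℝ) (hf : ∀ i, Antitone (f i)) (c : ℝ → ℝ)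
    (hc : Continuous c) (h : ∀ x, Tendsto (fun i => f i x) L (𝓝 (c x))) (y : ι → ℝ) (x : ℝ)
    (hy : Tendsto y L (𝓝 x)) : Tendsto (fun i => f i (y i)) L (𝓝 (c x)) := by
  rw [tendsto_order]
  constructor
  · intro a ha
    have h1 : ∀ᶠ w in 𝓝 x, a < c w := hc.continuousAt.eventually_const_lt ha
    obtain ⟨w, hw, hw2⟩ := ((h1.filter_mono nhdsWithin_le_nhds).and
      (self_mem_nhdsWithin : Ioi x ∈ 𝓝[>] x)).exists
    filter_upwards [(h w).eventually_const_lt hw, hy.eventually_lt_const hw2] with i h1 h2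
    exact h1.trans_le (hf i h2.le)
  · intro a ha
    have h1 : ∀ᶠ w in 𝓝 x, c w < a := hc.continuousAt.eventually_lt_const ha
    obtain ⟨w, hw, hw2⟩ := ((h1.filter_mono nhdsWithin_le_nhds).and
      (self_mem_nhdsWithin : Iio x ∈ 𝓝[<] x)).exists
    filter_upwards [(h w).eventually_lt_const hw, hy.eventually_const_lt hw2] with i h1 h2
    exact (hf i h2.le).trans_lt h1

lemma wpt_inv {ι : Type*} {L : Filter ι} (f : ι → ℝ → ℝ) (hf : ∀ i, Antitone (f i)) (c : ℝ → ℝ)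
    (h : ∀ x, Tendsto (fun i => f i x) L (𝓝 (c x))) (y : ι → ℝ) (x : ℝ)
    (h1 : ∀ u < x, c x < c u) (h2 : ∀ u > x, c u < c x)
    (hy : Tendsto (fun i => f i (y i)) L (𝓝 (c x))) : Tendsto y L (𝓝 x) := by
  rw [tendsto_order]
  constructor
  · intro a ha
    filter_upwards [hy.eventually_lt (h a) (h1 a ha)] with i hi
    by_contra hh
    exact absurd (hf i (not_lt.1 hh)) (not_le.2 hi)
  · intro a ha
    filter_upwards [(h a).eventually_lt hy (h2 a ha)] with i hi
    by_contra hh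
    exact absurd (hf i (not_lt.1 hh)) (not_le.2 hi)

lemma wpt_log (p : ℕ → ℝ) (h0 : ∀ n, 0 ≤ p n) (h1 : ∀ n, p n ≤ 1) (c : ℝ)
    (h : Tendsto (fun n => p n ^ n) atTop (𝓝 (Real.exp (-c)))) :
    Tendsto (fun n : ℕ => (n : ℝ) * (1 - p n)) atTop (𝓝 c) := by
  have hl : Tendsto (fun n : ℕ => (n : ℝ) * Real.log (p n)) atTop (𝓝 (-c)) := by
    have := h.log (Real.exp_pos _).ne'
    simpa [Real.log_pow] using this
  have hpos : ∀ᶠ n in atTop, 0 < p n := by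
    filter_upwards [h.eventually_const_lt (Real.exp_pos _), eventually_gt_atTop 0] with n hn hn0
    rcases (h0 n).lt_or_eq with h | h
    · exact h
    · rw [← h, zero_pow hn0.ne'] at hn
      exact absurd hn (lt_irrefl _)
  have hl0 : Tendsto (fun n : ℕ => Real.log (p n)) atTop (𝓝 0) := by
    have := hl.mul (tendsto_inv_atTop_nhds_zero_nat (𝕜 := ℝ))
    rw [mul_zero] at this
    refine this.congr' ?_
    filter_upwards [eventually_gt_atTop 0] with n hn
    have : (n : ℝ) ≠ 0 := by positivity
    field_simp
  have hp1 : Tendsto p atTop (𝓝 1) := by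
    have := (Real.continuous_exp.tendsto 0).comp hl0
    rw [Real.exp_zero] at this
    refine this.congr' ?_
    filter_upwards [hpos] with n hn
    simp [Real.exp_log hn]
  have hA : Tendsto (fun n : ℕ => -((n : ℝ) * Real.log (p n))) atTop (𝓝 c) := by
    simpa using hl.neg
  have hB := hp1.mul hA
  rw [one_mul] at hB
  refine tendsto_of_tendsto_of_tendsto_of_le_of_le' hB hA ?_ ?_
  · filter_upwards [hpos] with n hn
    have := Real.one_sub_inv_le_log_of_pos hn
    have h2 : p n * (1 - (p n)⁻¹) ≤ p n * Real.log (p n) := by gcongr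
    rw [mul_sub, mul_inv_cancel₀ hn.ne'] at h2
    have : (0:ℝ) ≤ n := by positivity
    nlinarith
  · filter_upwards [hpos] with n hn
    have := Real.log_le_sub_one_of_pos hn
    have : (0:ℝ) ≤ n := by positivity
    nlinarith

lemma wpt_weib (γ : ℝ) (hγ : 0 < γ) (x : ℝ) :
    weibullDF γ x = Real.exp (-((max (-x) 0) ^ γ)) := by
  unfold weibullDF
  split_ifs with h
  · rw [max_eq_left (by linarith)]
  · rw [max_eq_right (by linarith), Real.zero_rpow hγ.ne']; simp

lemma wpt_cont (γ : ℝ) (hγ : 0 < γ) : Continuous (fun x : ℝ => (max (-x) 0) ^ γ) := by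
  refine Continuous.rpow_const (by fun_prop) (fun x => Or.inr hγ.le)

lemma wpt_bounds {G : ℝ → ℝ} (hG : IsDF G) : (∀ x, 0 ≤ G x) ∧ ∀ x, G x ≤ 1 :=
  ⟨fun x => hG.1.le_of_tendsto hG.2.2.1 x, fun x => hG.1.ge_of_tendsto hG.2.2.2 x⟩

lemma wpt_dom {G : ℝ → ℝ} (hG : IsDF G) (γ : ℝ) (hγ : 0 < γ) (a b : ℕ → ℝ)
    (h : ∀ x, ContinuousAt (weibullDF γ) x →
      Tendsto (fun n => G (a n * x + b n) ^ n) atTop (𝓝 (weibullDF γ x))) (x : ℝ) :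
    Tendsto (fun n : ℕ => (n : ℝ) * (1 - G (a n * x + b n))) atTop (𝓝 ((max (-x) 0) ^ γ)) := by
  refine wpt_log _ (fun n => (wpt_bounds hG).1 _) (fun n => (wpt_bounds hG).2 _) _ ?_
  rw [← wpt_weib γ hγ]
  apply h
  have : weibullDF γ = fun x => Real.exp (-((max (-x) 0) ^ γ)) := funext (wpt_weib γ hγ)
  rw [this]
  exact (Real.continuous_exp.comp (wpt_cont γ hγ).neg).continuousAt

lemma wpt_part1 {G : ℝ → ℝ} (hG : IsDF G) (γ : ℝ) (hγ : 0 < γ)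
    (hdom : MemDomAttr G (weibullDF γ)) (r : ℝ) (hr : 0 < r) :
    MemDomAttr (fun x => 1 - (1 - G x) ^ r) (weibullDF (r * γ)) := by
  obtain ⟨a, b, ha, h⟩ := hdom
  have hU := wpt_dom hG γ hγ a b h
  have hb := wpt_bounds hG
  set m : ℕ → ℕ := fun n => ⌊(n : ℝ) ^ (1 / r)⌋₊ with hm
  have hpow : Tendsto (fun n : ℕ => (n : ℝ) ^ (1 / r)) atTop atTop :=
    (tendsto_rpow_atTop (by positivity)).comp tendsto_natCast_atTop_atTop
  have hmt : Tendsto m atTop atTop := tendsto_nat_floor_atTop.comp hpow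
  have hmr : Tendsto (fun n : ℕ => (((m n : ℝ) / (n : ℝ) ^ (1 / r)) ^ r)⁻¹) atTop (𝓝 1) := by
    have h1 : Tendsto (fun n : ℕ => (m n : ℝ) / (n : ℝ) ^ (1 / r)) atTop (𝓝 1) :=
      (tendsto_nat_floor_div_atTop (R := ℝ)).comp hpow
    have h2 := (h1.rpow_const (p := r) (Or.inr hr.le)).inv₀ (by simp)
    simpa using h2
  refine ⟨a ∘ m, b ∘ m, fun n => ha _, fun x _ => ?_⟩
  rw [wpt_weib _ (by positivity)]
  have key : Tendsto (fun n : ℕ => (n : ℝ) * (-(1 - G ((a ∘ m) n * x + (b ∘ m) n)) ^ r)) atTop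
      (𝓝 (-((max (-x) 0) ^ (r * γ)))) := by
    have h1 := (((hU x).comp hmt).rpow_const (p := r) (Or.inr hr.le)).mul hmr
    rw [mul_one, ← Real.rpow_mul (le_max_right _ _), mul_comm γ r] at h1
    refine h1.neg.congr' ?_
    filter_upwards [hmt.eventually_gt_atTop 0, eventually_gt_atTop 0] with n h2 h3
    have h4 : 0 ≤ 1 - G (a (m n) * x + b (m n)) := sub_nonneg.2 (hb.2 _)
    have h5 : (0:ℝ) < (m n : ℝ) := by exact_mod_cast h2
    have h6 : (0:ℝ) < (n : ℝ) := by exact_mod_cast h3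
    simp only [Function.comp_apply]
    rw [Real.mul_rpow h5.le h4, Real.div_rpow h5.le (by positivity), ← Real.rpow_mul h6.le,
      one_div_mul_cancel hr.ne', Real.rpow_one]
    have h7 : (0:ℝ) < (m n : ℝ) ^ r := by positivity
    field_simp
  have := Real.tendsto_one_add_pow_exp_of_tendsto key
  simpa [sub_eq_add_neg] using this

lemma wpt_geom (A b : ℕ → ℝ) (hA : ∀ k, 0 < A k) (q : ℝ) (hq1 : q < 1)
    (h1 : Tendsto (fun k => A (k + 1) / A k) atTop (𝓝 q))
    (h2 : Tendsto (fun k => (b (k + 1) - b k) / A k) atTop (𝓝 0)) :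
    Tendsto A atTop (𝓝 0) ∧ ∃ B, Tendsto (fun k => (B - b k) / A k) atTop (𝓝 0) := by
  have hs : Summable A := by
    refine summable_of_ratio_test_tendsto_lt_one hq1 (Eventually.of_forall fun k => (hA k).ne') ?_
    refine h1.congr fun k => ?_
    rw [Real.norm_of_nonneg (hA _).le, Real.norm_of_nonneg (hA _).le]
  have hA0 := hs.tendsto_atTop_zero
  refine ⟨hA0, ?_⟩
  have h2' : ∀ ε > 0, ∀ᶠ k in atTop, |b (k + 1) - b k| ≤ ε * A k := by
    intro ε hε
    filter_upwards [(Metric.tendsto_nhds.1 h2) ε hε] with k hk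
    rw [Real.dist_eq, sub_zero, abs_div, abs_of_pos (hA k), div_lt_iff₀ (hA k)] at hk
    exact hk.le
  have hsd : Summable (fun k => dist (b k) (b k.succ)) := by
    refine Summable.of_norm_bounded_eventually_nat hs ?_
    filter_upwards [h2' 1 one_pos] with k hk
    rw [Real.norm_of_nonneg dist_nonneg, dist_comm, Real.dist_eq]
    linarith
  obtain ⟨B, hB⟩ := cauchySeq_tendsto_of_complete (cauchySeq_of_summable_dist hsd)
  refine ⟨B, ?_⟩
  obtain ⟨ρ, hρ1, hρ2⟩ := exists_between hq1
  have hr : ∀ᶠ k in atTop, A (k + 1) ≤ ρ * A k := by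
    filter_upwards [h1.eventually_lt_const hρ1] with k hk
    rw [div_lt_iff₀ (hA k)] at hk
    exact hk.le
  have hρ : 0 < 1 - ρ := by linarith
  rw [Metric.tendsto_nhds]
  intro ε hε
  obtain ⟨N, hN⟩ := eventually_atTop.1 (hr.and (h2' (ε / 2 * (1 - ρ)) (by positivity)))
  filter_upwards [eventually_ge_atTop N] with k hk
  have key : ∀ j, |b (k + j) - b k| ≤ ε / 2 * (A k - A (k + j)) := by
    intro j
    induction j with
    | zero => simp
    | succ j ih =>
      obtain ⟨e1, e2⟩ := hN (k + j) (by omega)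
      rw [← add_assoc]
      have e3 : |b (k + j + 1) - b k| ≤ |b (k + j + 1) - b (k + j)| + |b (k + j) - b k| :=
        abs_sub_le _ _ _
      have : ε / 2 * A (k + j + 1) ≤ ε / 2 * (ρ * A (k + j)) := by gcongr
      nlinarith
  have hlim : Tendsto (fun j => |b (k + j) - b k|) atTop (𝓝 (|B - b k|)) := by
    have : Tendsto (fun j => b (k + j)) atTop (𝓝 B) :=
      hB.comp (tendsto_atTop_mono (fun j => Nat.le_add_left j k) tendsto_id)
    exact (this.sub_const _).abs
  have hle : |B - b k| ≤ ε / 2 * A k := by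
    refine le_of_tendsto hlim (Eventually.of_forall fun j => (key j).trans ?_)
    have := hA (k + j)
    gcongr
    linarith
  rw [Real.dist_eq, sub_zero, abs_div, abs_of_pos (hA k), div_lt_iff₀ (hA k)]
  have := hA k
  nlinarith

lemma wpt_types {G : ℝ → ℝ} (hG : IsDF G) (γ : ℝ) (hγ : 0 < γ)
    (hdom : MemDomAttr G (weibullDF γ)) :
    ∃ (A : ℕ → ℝ) (B q : ℝ), (∀ k, 0 < A k) ∧ Tendsto A atTop (𝓝 0) ∧ 0 < q ∧
      Tendsto (fun k => A (k + 1) / A k) atTop (𝓝 q) ∧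
      ∀ x, Tendsto (fun k : ℕ => (2 : ℝ) ^ k * (1 - G (A k * x + B))) atTop
        (𝓝 ((max (-x) 0) ^ γ)) := by
  obtain ⟨a, b, ha, h⟩ := hdom
  have hU := wpt_dom hG γ hγ a b h
  set c : ℝ → ℝ := fun x => (max (-x) 0) ^ γ with hc
  have hcc : Continuous c := wpt_cont γ hγ
  set A : ℕ → ℝ := fun k => a (2 ^ k) with hAdef
  set b' : ℕ → ℝ := fun k => b (2 ^ k) with hbdef
  have hA : ∀ k, 0 < A k := fun k => ha _
  set f : ℕ → ℝ → ℝ := fun k x => (2 : ℝ) ^ k * (1 - G (A k * x + b' k)) with hf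
  have hfa : ∀ k, Antitone (f k) := by
    intro k x y hxy
    have := hG.1 (show A k * x + b' k ≤ A k * y + b' k by
      have := (hA k).le
      gcongr)
    simp only [hf]
    gcongr
  have hfc : ∀ x, Tendsto (fun k => f k x) atTop (𝓝 (c x)) := by
    intro x
    have := (hU x).comp (tendsto_pow_atTop_atTop_of_one_lt (one_lt_two (α := ℕ)))
    refine this.congr fun k => ?_
    simp [hf, hAdef, hbdef]
  set q : ℝ := (2 : ℝ)⁻¹ ^ (1 / γ) with hq
  have hq0 : 0 < q := by positivity
  have hq1 : q < 1 := Real.rpow_lt_one (by norm_num) (by norm_num) (by positivity)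
  have hqγ : q ^ γ = 2⁻¹ := by
    rw [hq, ← Real.rpow_mul (by norm_num), one_div_mul_cancel hγ.ne', Real.rpow_one]
  have hstep : ∀ x < 0, Tendsto (fun k => (A (k + 1) * x + b' (k + 1) - b' k) / A k) atTop
      (𝓝 (q * x)) := by
    intro x hx
    have hqx : q * x < 0 := mul_neg_of_pos_of_neg hq0 hx
    refine wpt_inv f hfa c hfc _ _ ?_ ?_ ?_
    · intro u hu
      simp only [hc]
      rw [max_eq_left (by linarith), max_eq_left (by linarith)]
      exact Real.rpow_lt_rpow (by linarith) (by linarith) hγ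
    · intro u hu
      simp only [hc]
      rw [max_eq_left (a := -(q * x)) (by linarith)]
      exact Real.rpow_lt_rpow (le_max_right _ _) (max_lt (by linarith) (by linarith)) hγ
    · have h1 := ((hfc x).comp (tendsto_add_atTop_nat 1)).const_mul (2⁻¹ : ℝ)
      have h2 : 2⁻¹ * c x = c (q * x) := by
        simp only [hc]
        rw [max_eq_left (by linarith), max_eq_left (by linarith), ← mul_neg,
          Real.mul_rpow hq0.le (by linarith), hqγ]
      rw [h2] at h1
      refine h1.congr fun k => ?_
      simp only [hf, Function.comp_apply]
      rw [mul_div_cancel₀ _ (hA k).ne', sub_add_cancel, pow_succ]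
      ring
  have s1 := hstep (-1) (by norm_num)
  have s2 := hstep (-2) (by norm_num)
  have r1 : Tendsto (fun k => A (k + 1) / A k) atTop (𝓝 q) := by
    have := s1.sub s2
    rw [show q * (-1) - q * (-2) = q by ring] at this
    refine this.congr fun k => ?_
    have := (hA k).ne'
    field_simp
    ring
  have r2 : Tendsto (fun k => (b' (k + 1) - b' k) / A k) atTop (𝓝 0) := by
    have := s1.add r1
    rw [show q * (-1) + q = 0 by ring] at this
    refine this.congr fun k => ?_
    have := (hA k).ne'
    field_simp
    ring
  obtain ⟨hA0, B, hB⟩ := wpt_geom A b' hA q hq1 r1 r2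
  refine ⟨A, B, q, hA, hA0, hq0, r1, fun x => ?_⟩
  have := wpt_cc f hfa c hcc hfc (fun k => x + (B - b' k) / A k) x (by simpa using hB.const_add x)
  refine this.congr fun k => ?_
  simp only [hf]
  have e : A k * (x + (B - b' k) / A k) + b' k = A k * x + B := by
    have := (hA k).ne'
    field_simp
    ring
  rw [e]

lemma wpt_end {G : ℝ → ℝ} (hG : IsDF G) (γ : ℝ) (hγ : 0 < γ) (A : ℕ → ℝ) (B : ℝ)
    (hA : ∀ k, 0 < A k) (hA0 : Tendsto A atTop (𝓝 0))
    (h : ∀ x, Tendsto (fun k : ℕ => (2 : ℝ) ^ k * (1 - G (A k * x + B))) atTop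
        (𝓝 ((max (-x) 0) ^ γ))) : upEnd G = B ∧ ∀ y < B, G y < 1 := by
  have h1 : ∀ y < B, G y < 1 := by
    intro y hy
    have e := h (-1)
    simp only [neg_neg, zero_le_one, sup_of_le_left, Real.one_rpow] at e
    have e2 : Tendsto (fun k => A k * (-1) + B) atTop (𝓝 B) := by
      simpa using (hA0.mul_const (-1)).add_const B
    obtain ⟨k, hk1, hk2⟩ := ((e.eventually_const_lt one_pos).and
      (e2.eventually_const_lt hy)).exists
    have := hG.1 hk2.le
    have : 0 < 1 - G (A k * (-1) + B) := pos_of_mul_pos_right hk1 (by positivity)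
    linarith
  refine ⟨?_, h1⟩
  have h2 : ∀ y, G y < 1 → y ≤ B := by
    intro y hy
    by_contra hh
    push Not at hh
    have e := h 1
    have e0 : (max (-1:ℝ) 0) ^ γ = 0 := by
      rw [max_eq_right (by norm_num), Real.zero_rpow hγ.ne']
    rw [e0] at e
    have e2 : Tendsto (fun k => A k * 1 + B) atTop (𝓝 B) := by
      simpa using hA0.add_const B
    obtain ⟨k, hk1, hk2⟩ := ((e.eventually_lt_const (sub_pos.2 hy)).and
      (e2.eventually_lt_const hh)).exists
    have e3 := hG.1 hk2.le
    have : (1:ℝ) ≤ 2 ^ k := one_le_pow₀ (by norm_num)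
    nlinarith
  unfold upEnd
  refine csSup_eq_of_forall_le_of_forall_lt_exists_gt ⟨B - 1, h1 _ (by linarith)⟩ h2 ?_
  intro w hw
  obtain ⟨v, hv1, hv2⟩ := exists_between hw
  exact ⟨v, h1 v hv2, hv1⟩

lemma wpt_rv {G : ℝ → ℝ} (hG : IsDF G) (γ : ℝ) (hγ : 0 < γ) (A : ℕ → ℝ) (B q : ℝ)
    (hA : ∀ k, 0 < A k) (hA0 : Tendsto A atTop (𝓝 0)) (hq : 0 < q)
    (hAq : Tendsto (fun k => A (k + 1) / A k) atTop (𝓝 q))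
    (h : ∀ x, Tendsto (fun k : ℕ => (2 : ℝ) ^ k * (1 - G (A k * x + B))) atTop
        (𝓝 ((max (-x) 0) ^ γ))) (s : ℕ → ℝ) (hs : ∀ n, 0 < s n) (hs0 : Tendsto s atTop (𝓝 0))
    (t : ℝ) (ht : 0 < t) :
    Tendsto (fun n => (1 - G (B - s n * t)) / (1 - G (B - s n))) atTop (𝓝 (t ^ γ)) := by
  classical
  have hfa : ∀ k, Antitone (fun x => (2 : ℝ) ^ k * (1 - G (A k * x + B))) := by
    intro k x y hxy
    have := hG.1 (show A k * x + B ≤ A k * y + B by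
      have := (hA k).le
      gcongr)
    simp only
    gcongr
  have hK : ∀ n, ∃ k, A (k + 1) ≤ s n ∧ ∀ j, s n < A j → j ≤ k := by
    intro n
    have h1 : ∃ N, ∀ j ≥ N, A j < s n :=
      eventually_atTop.1 (hA0.eventually_lt_const (hs n))
    have h2 : ∃ N, ∀ j ≥ N + 1, A j ≤ s n := by
      obtain ⟨N, hN⟩ := h1
      exact ⟨N, fun j hj => (hN j (by omega)).le⟩
    refine ⟨Nat.find h2, Nat.find_spec h2 _ le_rfl, fun j hj => ?_⟩
    by_contra hh
    exact absurd (Nat.find_spec h2 j (by omega)) (not_le.2 hj)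
  have hK' : ∀ n, ∃ k, A (k + 1) ≤ s n ∧ (s n < A 0 → s n < A k) ∧ ∀ j, s n < A j → j ≤ k := by
    intro n
    have h1 : ∃ N, ∀ j ≥ N, A j < s n :=
      eventually_atTop.1 (hA0.eventually_lt_const (hs n))
    have h2 : ∃ N, ∀ j ≥ N + 1, A j ≤ s n := by
      obtain ⟨N, hN⟩ := h1
      exact ⟨N, fun j hj => (hN j (by omega)).le⟩
    refine ⟨Nat.find h2, Nat.find_spec h2 _ le_rfl, fun h0 => ?_, fun j hj => ?_⟩
    · by_contra hh
      push Not at hh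
      rcases Nat.eq_zero_or_pos (Nat.find h2) with h3 | h3
      · rw [h3] at hh; linarith
      · refine Nat.find_min h2 (m := Nat.find h2 - 1) (by omega) fun j hj => ?_
        rcases Nat.lt_or_ge (Nat.find h2) j with h4 | h4
        · exact Nat.find_spec h2 j (by omega)
        · have : j = Nat.find h2 := by omega
          rw [this]; exact hh
    · by_contra hh
      exact absurd (Nat.find_spec h2 j (by omega)) (not_le.2 hj)
  clear hK
  choose K hK1 hK2 hK3 using hK'
  have hKt : Tendsto K atTop atTop := by
    rw [tendsto_atTop]
    intro N
    filter_upwards [hs0.eventually_lt_const (hA N)] with n hn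
    exact hK3 n N hn
  set v : ℕ → ℝ := fun n => s n / A (K n) with hv
  have hvb : ∀ᶠ n in atTop, v n ∈ Icc (q / 2) 1 := by
    filter_upwards [hs0.eventually_lt_const (hA 0),
      (hAq.comp hKt).eventually_const_lt (show q / 2 < q by linarith)] with n h1 h2
    refine ⟨h2.le.trans ?_, ?_⟩
    · simp only [Function.comp_apply, hv]
      have := hA (K n)
      have := hK1 n
      gcongr
    · simp only [hv]
      rw [div_le_one (hA _)]
      exact (hK2 n h1).le
  refine tendsto_of_subseq_tendsto fun ns hns => ?_
  obtain ⟨w, hw, φ, hφ, hlim⟩ := (isCompact_Icc (a := q / 2) (b := (1:ℝ))).isSeqCompact.subseq_of_frequently_in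
    (x := v ∘ ns) ((hns.eventually hvb).frequently)
  refine ⟨φ, ?_⟩
  have hw0 : 0 < w := lt_of_lt_of_le (by positivity) hw.1
  have hsub : Tendsto (fun n => K (ns (φ n))) atTop atTop :=
    hKt.comp (hns.comp hφ.tendsto_atTop)
  have key : ∀ τ > 0, Tendsto (fun n => (2 : ℝ) ^ (K (ns (φ n))) * (1 - G (B - s (ns (φ n)) * τ)))
      atTop (𝓝 ((w * τ) ^ γ)) := by
    intro τ hτ
    have e := wpt_cc (L := atTop)
      (fun n x => (2 : ℝ) ^ (K (ns (φ n))) * (1 - G (A (K (ns (φ n))) * x + B)))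
      (fun n => hfa _) _ (wpt_cont γ hγ) (fun x => (h x).comp hsub)
      (fun n => - (v (ns (φ n)) * τ)) (-(w * τ)) ((hlim.mul_const τ).neg)
    simp only [neg_neg] at e
    rw [max_eq_left (by positivity)] at e
    refine e.congr fun n => ?_
    have : A (K (ns (φ n))) * -(v (ns (φ n)) * τ) + B = B - s (ns (φ n)) * τ := by
      simp only [hv]
      have := (hA (K (ns (φ n)))).ne'
      field_simp
      ring
    rw [this]
  have e1 := (key t ht).div (key 1 one_pos) (by positivity)
  rw [Real.mul_rpow hw0.le ht.le, mul_one, mul_div_cancel_left₀ _ (by positivity)] at e1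
  refine e1.congr fun n => ?_
  simp only [Pi.div_apply, mul_one]
  rw [mul_div_mul_left _ _ (by positivity)]

lemma wpt_int {V : ℝ → ℝ} (hV : Antitone V) (B δ : ℝ) (hδ : 0 < δ) (hpos : ∀ y < B, 0 < V y)
    (x z : ℕ → ℝ) (hx : ∀ᶠ n in atTop, x n < B) (hz : ∀ᶠ n in atTop, z n < B)
    (hxz : ∀ n, x n < z n)
    (hrv : ∀ t > 0, Tendsto (fun n => V (B - (B - x n) * t) / V (x n)) atTop (𝓝 (t ^ δ)))
    (h0 : Tendsto (fun n => V (z n) / V (x n)) atTop (𝓝 0)) :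
    Tendsto (fun n => (V (x n))⁻¹ * (∫ t in x n..z n, V t) / (B - x n)) atTop
      (𝓝 (1 / (δ + 1))) := by
  set w : ℕ → ℝ := fun n => (B - z n) / (B - x n) with hw
  have hw0 : ∀ᶠ n in atTop, 0 < w n ∧ w n < 1 := by
    filter_upwards [hx, hz] with n h1 h2
    have := hxz n
    exact ⟨div_pos (by linarith) (by linarith), (div_lt_one (by linarith)).2 (by linarith)⟩
  have hwlt : ∀ ε > 0, ∀ᶠ n in atTop, w n < ε := by
    intro ε hε
    filter_upwards [h0.eventually_lt (hrv ε hε) (by positivity), hx] with n h1 h2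
    by_contra hh
    push Not at hh
    have hp := hpos _ h2
    rw [div_lt_div_iff_of_pos_right hp] at h1
    refine absurd (hV ?_) (not_le.2 h1)
    simp only [hw] at hh
    rw [le_div_iff₀ (by linarith)] at hh
    linarith
  have hmain : Tendsto (fun n => ∫ t in (0:ℝ)..1,
      (Ioc (w n) 1).indicator (fun t => V (B - (B - x n) * t) / V (x n)) t) atTop
      (𝓝 (∫ t in (0:ℝ)..1, t ^ δ)) := by
    refine intervalIntegral.tendsto_integral_filter_of_dominated_convergence (fun _ => 1) ?_ ?_ ?_ ?_
    · filter_upwards with n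
      refine (Measurable.indicator ?_ measurableSet_Ioc).aestronglyMeasurable
      exact (hV.measurable.comp (by fun_prop)).div_const _
    · filter_upwards [hx, hz, hw0] with n h1 h2 h3
      refine Eventually.of_forall fun t ht => ?_
      rw [uIoc_of_le zero_le_one] at ht
      have hp := hpos _ h1
      by_cases hm : t ∈ Ioc (w n) 1
      · rw [indicator_of_mem hm]
        have hlt : B - (B - x n) * t < B := by nlinarith [ht.1]
        have hp2 := hpos _ hlt
        rw [Real.norm_of_nonneg (by positivity), div_le_one hp]
        apply hV
        nlinarith [ht.2]
      · rw [indicator_of_notMem hm]; simp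
    · simp
    · refine Eventually.of_forall fun t ht => ?_
      rw [uIoc_of_le zero_le_one] at ht
      refine (hrv t ht.1).congr' ?_
      filter_upwards [hwlt t ht.1] with n hn
      rw [indicator_of_mem (show t ∈ Ioc (w n) 1 from ⟨hn, ht.2⟩)]
  have hval : (∫ t in (0:ℝ)..1, t ^ δ) = 1 / (δ + 1) := by
    rw [integral_rpow (Or.inl (by linarith))]
    simp [Real.zero_rpow (by linarith : δ + 1 ≠ 0)]
  rw [hval] at hmain
  refine hmain.congr' ?_
  filter_upwards [hx, hz, hw0] with n h1 h2 h3
  have hs : B - x n ≠ 0 := by linarith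
  rw [intervalIntegral.integral_of_le zero_le_one, setIntegral_indicator measurableSet_Ioc]
  have : Ioc (0:ℝ) 1 ∩ Ioc (w n) 1 = Ioc (w n) 1 :=
    inter_eq_right.2 (Ioc_subset_Ioc_left h3.1.le)
  rw [this, ← intervalIntegral.integral_of_le h3.2.le, intervalIntegral.integral_div,
    intervalIntegral.integral_comp_sub_mul _ hs]
  have e1 : B - (B - x n) * 1 = x n := by ring
  have e2 : B - (B - x n) * w n = z n := by
    simp only [hw]; field_simp; ring
  rw [e1, e2, smul_eq_mul]
  have := (hpos _ h1).ne'
  field_simp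

/-- Lemma 3.3(i). -/
theorem weibull_power_transform (G : ℝ → ℝ) (hG : IsDF G) (γ : ℝ) (hγ : 0 < γ)
    (hdom : MemDomAttr G (weibullDF γ)) (r : ℝ) (hr : 0 < r)
    (Gr : ℝ → ℝ) (hGr : Gr = fun x => 1 - (1 - G x) ^ r) :
    MemDomAttr Gr (weibullDF (r * γ)) ∧
    upEnd G = upEnd Gr ∧
    (∀ x z : ℕ → ℝ,
      Tendsto x atTop (𝓝[<] upEnd G) →
      Tendsto z atTop (𝓝[<] upEnd G) →
      (∀ n, x n < z n) →
      Tendsto (fun n => (1 - G (z n)) / (1 - G (x n))) atTop (𝓝 0) →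
      Tendsto (fun n => Rp 1 (x n) (z n) G / Rp 1 (x n) (z n) Gr) atTop
        (𝓝 ((r * γ + 1) / (γ + 1)))) := by
  have hb := wpt_bounds hG
  have hset : {x | G x < 1} = {x | Gr x < 1} := by
    ext x
    simp only [hGr, mem_ofPred_eq]
    have h0 : 0 ≤ 1 - G x := sub_nonneg.2 (hb.2 x)
    constructor
    · intro h
      have : 0 < (1 - G x) ^ r := Real.rpow_pos_of_pos (by linarith) r
      linarith
    · intro h
      rcases h0.lt_or_eq with h1 | h1
      · linarith
      · rw [← h1, Real.zero_rpow hr.ne'] at h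
        linarith
  refine ⟨by rw [hGr]; exact wpt_part1 hG γ hγ hdom r hr, by simp only [upEnd, hset], ?_⟩
  obtain ⟨A, B, q, hA, hA0, hq, hAq, h⟩ := wpt_types hG γ hγ hdom
  obtain ⟨hB, hlt⟩ := wpt_end hG γ hγ A B hA hA0 h
  rw [hB]
  intro x z hx hz hxz h0
  have hx1 : ∀ᶠ n in atTop, x n < B := hx.eventually self_mem_nhdsWithin
  have hz1 : ∀ᶠ n in atTop, z n < B := hz.eventually self_mem_nhdsWithin
  have hx2 : Tendsto x atTop (𝓝 B) := hx.mono_right nhdsWithin_le_nhds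
  have hrv : ∀ t > 0, Tendsto (fun n => (1 - G (B - (B - x n) * t)) / (1 - G (x n))) atTop
      (𝓝 (t ^ γ)) := by
    intro t ht
    have e := wpt_rv hG γ hγ A B q hA hA0 hq hAq h (fun n => if x n < B then B - x n else 1)
      (fun n => by split_ifs <;> linarith) (by
        have : Tendsto (fun n => B - x n) atTop (𝓝 0) := by simpa using hx2.const_sub B
        refine this.congr' ?_
        filter_upwards [hx1] with n hn
        rw [if_pos hn]) t ht
    refine e.congr' ?_
    filter_upwards [hx1] with n hn
    rw [if_pos hn, sub_sub_cancel B (x n)]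
  have i1 := wpt_int (V := fun y => 1 - G y) (fun a b hab => by
      have := hG.1 hab
      simp only
      linarith) B γ hγ
    (fun y hy => sub_pos.2 (hlt y hy)) x z hx1 hz1 hxz hrv h0
  have hnn : ∀ y, 0 ≤ 1 - G y := fun y => sub_nonneg.2 (hb.2 y)
  have i2 := wpt_int (V := fun y => (1 - G y) ^ r) (fun a b hab => by
      have := hG.1 hab
      exact Real.rpow_le_rpow (hnn b) (by linarith) hr.le) B (r * γ) (by positivity)
    (fun y hy => Real.rpow_pos_of_pos (sub_pos.2 (hlt y hy)) r) x z hx1 hz1 hxz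
    (fun t ht => by
      have e := (hrv t ht).rpow_const (p := r) (Or.inr hr.le)
      rw [← Real.rpow_mul ht.le, mul_comm γ r] at e
      exact e.congr fun n => Real.div_rpow (hnn _) (hnn _) r)
    (by
      have e := h0.rpow_const (p := r) (Or.inr hr.le)
      rw [Real.zero_rpow hr.ne'] at e
      exact e.congr fun n => Real.div_rpow (hnn _) (hnn _) r)
  have hrg : 0 < r * γ := by positivity
  have e := i1.div i2 (by positivity)
  have hc : 1 / (γ + 1) / (1 / (r * γ + 1)) = (r * γ + 1) / (γ + 1) := by
    field_simp
  rw [hc] at e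
  refine e.congr' ?_
  filter_upwards [hx1] with n hn
  have hs : B - x n ≠ 0 := by linarith
  simp only [Pi.div_apply, Rp, Nat.sub_self, iterInt, hGr, sub_sub_cancel]
  rw [div_div_div_cancel_right₀ hs]

end
end

section
/- Lemma 3.3(ii): let G be a distribution function with G ∈ D(Λ), and for r > 0 set G_r(x) = 1 − (1 − G(x))^r. Then G_r ∈ D(Λ), the upper endpoints coincide: x₀(G) = x₀(G_r) =: y₀, and R_1(x, z, G)/R_1(x, z, G_r) → r as x → y₀ and z → y₀ with (1 − G(z))/(1 − G(x)) → 0. -/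
open MeasureTheory Filter Topology Set

noncomputable section

lemma aux_nH (g : ℕ → ℝ) (hg0 : ∀ n, 0 ≤ g n) (c : ℝ)
    (h : Tendsto (fun n => g n ^ n) atTop (𝓝 (Real.exp (-c)))) :
    Tendsto (fun n : ℕ => (n : ℝ) * (1 - g n)) atTop (𝓝 c) := by
  have hpos : ∀ᶠ n in atTop, 0 < g n ^ n := h.eventually (lt_mem_nhds (Real.exp_pos _))
  have hgpos : ∀ᶠ n in atTop, 0 < g n := by
    filter_upwards [hpos, eventually_ge_atTop 1] with n hn h1
    rcases (hg0 n).lt_or_eq with h2 | h2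
    · exact h2
    · rw [← h2, zero_pow (by omega)] at hn
      exact absurd hn (lt_irrefl _)
  have hl : Tendsto (fun n : ℕ => (n : ℝ) * Real.log (g n)) atTop (𝓝 (-c)) := by
    have := (Real.continuousAt_log (Real.exp_pos (-c)).ne').tendsto.comp h
    rw [Real.log_exp] at this
    refine this.congr (fun n => ?_)
    simp [Real.log_pow]
  have hl0 : Tendsto (fun n : ℕ => Real.log (g n)) atTop (𝓝 0) := by
    have := hl.mul (tendsto_inv_atTop_nhds_zero_nat (𝕜 := ℝ))
    rw [mul_zero] at this
    refine this.congr' ?_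
    filter_upwards [eventually_ge_atTop 1] with n hn
    have : (n : ℝ) ≠ 0 := by positivity
    field_simp
  have he : Tendsto (fun n : ℕ => Real.exp (Real.log (g n))) atTop (𝓝 1) := by
    have := (Real.continuous_exp.tendsto 0).comp hl0
    simpa [Function.comp_def] using this
  have hlow : Tendsto (fun n : ℕ => -((n : ℝ) * Real.log (g n)) * Real.exp (Real.log (g n))) atTop (𝓝 c) := by
    simpa using hl.neg.mul he
  have hup : Tendsto (fun n : ℕ => -((n : ℝ) * Real.log (g n))) atTop (𝓝 c) := by
    simpa using hl.neg
  refine tendsto_of_tendsto_of_tendsto_of_le_of_le' hlow hup ?_ ?_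
  · filter_upwards [hgpos] with n hn
    set l := Real.log (g n) with hld
    have e1 : g n = Real.exp l := (Real.exp_log hn).symm
    rw [e1]
    have h1 := Real.add_one_le_exp (-l)
    have h2 : Real.exp (-l) * Real.exp l = 1 := by rw [← Real.exp_add]; simp
    have h3 := mul_le_mul_of_nonneg_right h1 (Real.exp_pos l).le
    rw [h2] at h3
    have h4 : -l * Real.exp l ≤ 1 - Real.exp l := by linarith
    have := mul_le_mul_of_nonneg_left h4 (Nat.cast_nonneg (α := ℝ) n)
    linarith
  · filter_upwards [hgpos] with n hn
    have h1 := Real.add_one_le_exp (Real.log (g n))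
    rw [Real.exp_log hn] at h1
    have h4 : 1 - g n ≤ - Real.log (g n) := by linarith
    have := mul_le_mul_of_nonneg_left h4 (Nat.cast_nonneg (α := ℝ) n)
    linarith

lemma aux_real (G : ℝ → ℝ) (hG0 : ∀ x, 0 ≤ G x) (hdom : MemDomAttr G gumbelDF) :
    ∃ A B : ℝ → ℝ, (∀ τ, 0 < A τ) ∧ ∀ s, Tendsto (fun τ => τ * (1 - G (A τ * s + B τ))) atTop
      (𝓝 (Real.exp (-s))) := by
  obtain ⟨a, b, ha, h⟩ := hdom
  refine ⟨fun τ => a ⌊τ⌋₊, fun τ => b ⌊τ⌋₊, fun τ => ha _, fun s => ?_⟩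
  have hc : ContinuousAt gumbelDF s := by
    unfold gumbelDF
    fun_prop
  have h1 := aux_nH _ (fun n => hG0 _) _ (h s hc)
  have h2 := h1.comp (tendsto_nat_floor_atTop (α := ℝ))
  have h3 := h2.mul ((tendsto_nat_floor_div_atTop (R := ℝ)).inv₀ one_ne_zero)
  rw [inv_one, mul_one] at h3
  refine h3.congr' ?_
  filter_upwards [eventually_ge_atTop 1] with τ hτ
  have : 0 < ⌊τ⌋₊ := Nat.floor_pos.2 hτ
  have : (0:ℝ) < ⌊τ⌋₊ := by exact_mod_cast this
  have : 0 < τ := by linarith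
  simp only [Function.comp]
  field_simp

/-- First part. -/
lemma aux_part1 (G : ℝ → ℝ) (hG0 : ∀ x, 0 ≤ G x) (hG1 : ∀ x, G x ≤ 1)
    (hdom : MemDomAttr G gumbelDF) (r : ℝ) (hr : 0 < r) :
    MemDomAttr (fun x => 1 - (1 - G x) ^ r) gumbelDF := by
  obtain ⟨A, B, hA, h⟩ := aux_real G hG0 hdom
  refine ⟨fun n => A ((n:ℝ) ^ r⁻¹) / r, fun n => B ((n:ℝ) ^ r⁻¹), fun n => div_pos (hA _) hr,
    fun x _ => ?_⟩
  have h1 : Tendsto (fun n : ℕ => (n:ℝ) ^ r⁻¹) atTop atTop :=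
    (tendsto_rpow_atTop (inv_pos.2 hr)).comp tendsto_natCast_atTop_atTop
  have h2 := ((h (x / r)).comp h1).rpow_const (p := r) (Or.inr hr.le)
  have h3 : Tendsto (fun n : ℕ => (n:ℝ) * -((1 - G (A ((n:ℝ) ^ r⁻¹) / r * x + B ((n:ℝ) ^ r⁻¹))) ^ r))
      atTop (𝓝 (-Real.exp (-x))) := by
    have e : Real.exp (-(x / r)) ^ r = Real.exp (-x) := by
      rw [← Real.exp_mul]; congr 1; field_simp
    rw [e] at h2
    refine h2.neg.congr (fun n => ?_)
    simp only [Function.comp]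
    rw [Real.mul_rpow (by positivity) (by linarith [hG1 (A ((n:ℝ) ^ r⁻¹) * (x / r) + B ((n:ℝ) ^ r⁻¹))]),
      ← Real.rpow_mul (by positivity), inv_mul_cancel₀ hr.ne', Real.rpow_one]
    rw [mul_neg]
    congr 5
    ring
  have h4 := Real.tendsto_one_add_pow_exp_of_tendsto h3
  exact h4

lemma aux_potter (H f : ℝ → ℝ) (hH : Antitone H) (hf : ∀ t, 0 < f t) (δ m p : ℝ)
    (hm : 0 < m) (hp : 0 < p) (hmp : ((m + 1) / m) ^ p = 2)
    (hstep : ∀ t, 0 < H t → H t < δ →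
      0 < H (t + f t) ∧ H (t + f t) ≤ H t / 2 ∧ f (t + f t) ≤ (m + 1) / m * f t) :
    ∀ K : ℕ, ∀ s : ℝ, 0 ≤ s → s ≤ K → ∀ t, 0 < H t → H t < δ →
      H (t + s * f t) ≤ 2 * ((s + m) / m) ^ (-p) * H t := by
  have small : ∀ s, 0 ≤ s → s ≤ 1 → ∀ t, 0 < H t → 
      H (t + s * f t) ≤ 2 * ((s + m) / m) ^ (-p) * H t := by
    intro s hs0 hs1 t ht
    have h1 : H (t + s * f t) ≤ H t := hH (by have := mul_nonneg hs0 (hf t).le; linarith)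
    have h2 : ((s + m) / m) ^ p ≤ 2 := by
      rw [← hmp]
      apply Real.rpow_le_rpow (by positivity) _ hp.le
      apply div_le_div_of_nonneg_right _ hm.le
      linarith
    have h3 : 0 < ((s + m) / m) ^ p := by positivity
    have h4 : 1 ≤ 2 * ((s + m) / m) ^ (-p) := by
      rw [Real.rpow_neg (by positivity), ← div_eq_mul_inv, le_div_iff₀ h3]
      linarith
    nlinarith
  intro K
  induction K with
  | zero =>
    intro s hs0 hs1 t ht _
    exact small s hs0 (by push_cast at hs1; linarith) t ht
  | succ K ih =>
    intro s hs0 hs1 t ht htδ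
    rcases le_or_gt s 1 with h | h
    · exact small s hs0 h t ht
    obtain ⟨g1, g2, g3⟩ := hstep t ht htδ
    push_cast at hs1
    set t' := t + f t with ht'
    have hs'0 : 0 ≤ (s - 1) * m / (m + 1) := by
      apply div_nonneg (mul_nonneg (by linarith) hm.le) (by linarith)
    have hs'1 : (s - 1) * m / (m + 1) ≤ K := by
      rw [div_le_iff₀ (by linarith)]
      have : (0:ℝ) ≤ K := Nat.cast_nonneg K
      nlinarith
    have hi := ih _ hs'0 hs'1 t' g1 (by linarith)
    have e1 : H (t + s * f t) ≤ H (t' + (s - 1) * m / (m + 1) * f t') := by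
      apply hH
      have : (s - 1) * m / (m + 1) * f t' ≤ (s - 1) * m / (m + 1) * ((m + 1) / m * f t) :=
        mul_le_mul_of_nonneg_left g3 hs'0
      have e : (s - 1) * m / (m + 1) * ((m + 1) / m * f t) = (s - 1) * f t := by
        field_simp
      rw [e] at this
      rw [ht'] at this ⊢
      linarith
    have e2 : ((s - 1) * m / (m + 1) + m) / m = ((s + m) / m) / ((m + 1) / m) := by
      field_simp
      ring
    have e3 : (((s - 1) * m / (m + 1) + m) / m) ^ (-p) = 2 * ((s + m) / m) ^ (-p) := by
      rw [e2, Real.div_rpow (by positivity) (by positivity), Real.rpow_neg (x := (m+1)/m) (by positivity), hmp]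
      field_simp
    rw [e3] at hi
    have h3 : 0 < ((s + m) / m) ^ (-p) := by positivity
    calc H (t + s * f t) ≤ _ := e1
      _ ≤ _ := hi
      _ ≤ 2 * (2 * ((s + m) / m) ^ (-p)) * (H t / 2) := by gcongr
      _ = _ := by ring

lemma aux_f (H A B : ℝ → ℝ) (hH : Antitone H)
    (h : ∀ s, Tendsto (fun τ => τ * H (A τ * s + B τ)) atTop (𝓝 (Real.exp (-s))))
    (hA : ∀ τ, 0 < A τ) (s : ℝ) :
    Tendsto (fun t => H (t + s * A (H t)⁻¹) / H t) (comap H (𝓝[>] 0)) (𝓝 (Real.exp (-s))) := by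
  have hHt : Tendsto H (comap H (𝓝[>] 0)) (𝓝[>] 0) := tendsto_comap
  have hpos : ∀ᶠ t in comap H (𝓝[>] 0), 0 < H t := hHt.eventually self_mem_nhdsWithin
  have hτ : Tendsto (fun t => (H t)⁻¹) (comap H (𝓝[>] 0)) atTop := tendsto_inv_nhdsGT_zero.comp hHt
  have P : ∀ s, Tendsto (fun t => (H t)⁻¹ * H (A (H t)⁻¹ * s + B (H t)⁻¹)) (comap H (𝓝[>] 0))
      (𝓝 (Real.exp (-s))) := fun s => (h s).comp hτ
  have lo : ∀ η, 0 < η → ∀ᶠ t in comap H (𝓝[>] 0), A (H t)⁻¹ * (-η) + B (H t)⁻¹ < t := by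
    intro η hη
    have h1 : (1:ℝ) < Real.exp (-(-η)) := by
      rw [neg_neg]; exact Real.one_lt_exp_iff.2 hη
    filter_upwards [(P (-η)).eventually (lt_mem_nhds h1), hpos] with t h2 h3
    rw [inv_mul_eq_div, lt_div_iff₀ h3, one_mul] at h2
    by_contra hc
    exact absurd (hH (not_lt.1 hc)) (not_le.2 h2)
  have hi : ∀ η, 0 < η → ∀ᶠ t in comap H (𝓝[>] 0), t < A (H t)⁻¹ * η + B (H t)⁻¹ := by
    intro η hη
    have h1 : Real.exp (-η) < 1 := by
      rw [← Real.exp_zero]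
      exact Real.exp_lt_exp.2 (by linarith)
    filter_upwards [(P η).eventually (gt_mem_nhds h1), hpos] with t h2 h3
    rw [inv_mul_eq_div, div_lt_iff₀ h3, one_mul] at h2
    by_contra hc
    exact absurd (hH (not_lt.1 hc)) (not_le.2 h2)
  have cont : ∀ σ : ℝ, Tendsto (fun η : ℝ => Real.exp (-(s + σ * η))) (𝓝[>] 0) (𝓝 (Real.exp (-s))) := by
    intro σ
    have : Continuous (fun η : ℝ => Real.exp (-(s + σ * η))) := by fun_prop
    have := this.tendsto 0
    simp only [mul_zero, add_zero] at this
    exact this.mono_left nhdsWithin_le_nhds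
  rw [tendsto_order]
  constructor
  · intro c hc
    obtain ⟨η, h1, h2⟩ := (((cont 1).eventually (lt_mem_nhds hc)).and self_mem_nhdsWithin).exists
    have h2 : 0 < η := h2
    filter_upwards [(P (s + 1 * η)).eventually (lt_mem_nhds h1), hi η h2, hpos] with t g1 g2 g3
    refine g1.trans_le ?_
    rw [inv_mul_eq_div]
    apply div_le_div_of_nonneg_right _ g3.le
    apply hH
    nlinarith
  · intro c hc
    obtain ⟨η, h1, h2⟩ := (((cont (-1)).eventually (gt_mem_nhds hc)).and self_mem_nhdsWithin).exists
    have h2 : 0 < η := h2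
    filter_upwards [(P (s + -1 * η)).eventually (gt_mem_nhds h1), lo η h2, hpos] with t g1 g2 g3
    refine lt_of_le_of_lt ?_ g1
    rw [inv_mul_eq_div]
    apply div_le_div_of_nonneg_right _ g3.le
    apply hH
    nlinarith

lemma aux_T (H f : ℝ → ℝ)
    (h : ∀ s, Tendsto (fun t => H (t + s * f t) / H t) (comap H (𝓝[>] 0)) (𝓝 (Real.exp (-s)))) :
    Tendsto (fun t => t + f t) (comap H (𝓝[>] 0)) (comap H (𝓝[>] 0)) := by
  have hHt : Tendsto H (comap H (𝓝[>] 0)) (𝓝[>] 0) := tendsto_comap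
  have hpos : ∀ᶠ t in comap H (𝓝[>] 0), 0 < H t := hHt.eventually self_mem_nhdsWithin
  rw [tendsto_comap_iff, tendsto_nhdsWithin_iff]
  constructor
  · have := (h 1).mul (hHt.mono_right nhdsWithin_le_nhds)
    rw [mul_zero] at this
    refine this.congr' ?_
    filter_upwards [hpos] with t ht
    simp only [Function.comp, one_mul]
    field_simp
  · filter_upwards [hpos, (h 1).eventually (lt_mem_nhds (Real.exp_pos _))] with t ht h1
    rw [one_mul] at h1
    exact (div_pos_iff_of_pos_right ht).1 h1

lemma aux_self (H f : ℝ → ℝ) (hH : Antitone H)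
    (h : ∀ s, Tendsto (fun t => H (t + s * f t) / H t) (comap H (𝓝[>] 0)) (𝓝 (Real.exp (-s))))
    (q : ℝ) (hq : 1 < q) :
    ∀ᶠ t in comap H (𝓝[>] 0), f (t + f t) ≤ q * f t := by
  have hHt : Tendsto H (comap H (𝓝[>] 0)) (𝓝[>] 0) := tendsto_comap
  have hpos : ∀ᶠ t in comap H (𝓝[>] 0), 0 < H t := hHt.eventually self_mem_nhdsWithin
  have hT := aux_T H f h
  have h1 := (h 1).comp hT
  have h2 := (h (1 + q)).div (h 1) (Real.exp_pos _).ne'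
  have e : Real.exp (-(1 + q)) / Real.exp (-1) = Real.exp (-q) := by
    rw [← Real.exp_sub]; congr 1; ring
  rw [e] at h2
  have hlt : Real.exp (-q) < Real.exp (-1) := Real.exp_lt_exp.2 (by linarith)
  filter_upwards [h2.eventually_lt h1 hlt, hpos, hT.eventually hpos] with t g1 g2 g3
  simp only [Function.comp, one_mul, Pi.div_apply] at g1
  rw [div_div_div_cancel_right₀ g2.ne', div_lt_div_iff_of_pos_right g3] at g1
  by_contra hc
  push Not at hc
  exact absurd (hH (show t + (1 + q) * f t ≤ t + f t + f (t + f t) by linarith)) (not_le.2 g1)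

lemma aux_bound (H f : ℝ → ℝ) (hH : Antitone H) (hf : ∀ t, 0 < f t)
    (h : ∀ s, Tendsto (fun t => H (t + s * f t) / H t) (comap H (𝓝[>] 0)) (𝓝 (Real.exp (-s))))
    (p : ℝ) (hp : 0 < p) :
    ∃ m : ℝ, 0 < m ∧ ∀ᶠ t in comap H (𝓝[>] 0), 0 < H t ∧ ∀ s : ℝ, 0 ≤ s →
      H (t + s * f t) ≤ 2 * ((s + m) / m) ^ (-p) * H t := by
  have hHt : Tendsto H (comap H (𝓝[>] 0)) (𝓝[>] 0) := tendsto_comap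
  have hpos : ∀ᶠ t in comap H (𝓝[>] 0), 0 < H t := hHt.eventually self_mem_nhdsWithin
  have hT := aux_T H f h
  have hq : (1:ℝ) < 2 ^ p⁻¹ := Real.one_lt_rpow (by norm_num) (inv_pos.2 hp)
  have hq' : (0:ℝ) < 2 ^ p⁻¹ - 1 := by linarith
  set m : ℝ := (2 ^ p⁻¹ - 1)⁻¹ with hm
  have hm0 : 0 < m := inv_pos.2 hq'
  have hmq : (m + 1) / m = 2 ^ p⁻¹ := by
    rw [add_div, div_self hm0.ne', one_div, hm, inv_inv]
    ring
  have hmp : ((m + 1) / m) ^ p = 2 := by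
    rw [hmq, ← Real.rpow_mul (by norm_num), inv_mul_cancel₀ hp.ne', Real.rpow_one]
  have hhalf : Real.exp (-1) < 1 / 2 := by
    have := Real.exp_neg_one_lt_d9
    linarith
  have ev : ∀ᶠ t in comap H (𝓝[>] 0), 
      0 < H (t + f t) ∧ H (t + f t) ≤ H t / 2 ∧ f (t + f t) ≤ (m + 1) / m * f t := by
    filter_upwards [hpos, hT.eventually hpos, (h 1).eventually (gt_mem_nhds hhalf),
      aux_self H f hH h _ (hmq ▸ hq)] with t g1 g2 g3 g4
    refine ⟨g2, ?_, g4⟩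
    rw [one_mul, div_lt_iff₀ g1] at g3
    linarith
  rw [eventually_comap, eventually_nhdsWithin_iff, Metric.eventually_nhds_iff] at ev
  obtain ⟨δ, hδ, ev⟩ := ev
  have hstep : ∀ t, 0 < H t → H t < δ →
      0 < H (t + f t) ∧ H (t + f t) ≤ H t / 2 ∧ f (t + f t) ≤ (m + 1) / m * f t := by
    intro t h1 h2
    exact ev (y := H t) (by rw [Real.dist_eq, sub_zero, abs_of_pos h1]; exact h2) h1 t rfl
  refine ⟨m, hm0, ?_⟩
  filter_upwards [hpos, (hHt.mono_right nhdsWithin_le_nhds).eventually (gt_mem_nhds hδ)] with t g1 g2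
  refine ⟨g1, fun s hs => ?_⟩
  exact aux_potter H f hH hf δ m p hm0 hp hmp hstep ⌈s⌉₊ s hs (Nat.le_ceil s) t g1 g2

lemma aux_int_s6 (H f : ℝ → ℝ) (hH : Antitone H) (hH0 : ∀ t, 0 ≤ H t) (hf : ∀ t, 0 < f t)
    (h : ∀ s, Tendsto (fun t => H (t + s * f t) / H t) (comap H (𝓝[>] 0)) (𝓝 (Real.exp (-s))))
    (r : ℝ) (hr : 0 < r) (x z : ℕ → ℝ) (hx : Tendsto x atTop (comap H (𝓝[>] 0)))
    (hxz : ∀ n, x n < z n) (hz : Tendsto (fun n => H (z n) / H (x n)) atTop (𝓝 0)) :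
    Tendsto (fun n => (H (x n) ^ r)⁻¹ * (∫ t in (x n)..(z n), H t ^ r) / f (x n)) atTop
      (𝓝 (1 / r)) := by
  obtain ⟨m, hm, hb⟩ := aux_bound H f hH hf h (2 / r) (by positivity)
  have hb' := hx.eventually hb
  set F : ℕ → ℝ → ℝ := fun n => (Set.Ioc 0 ((z n - x n) / f (x n))).indicator
    (fun s => (H (f (x n) * s + x n) / H (x n)) ^ r) with hF
  have key : Tendsto (fun n => ∫ s in Set.Ioi (0:ℝ), F n s) atTop
      (𝓝 (∫ s in Set.Ioi (0:ℝ), Real.exp (-r * s))) := by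
    apply tendsto_integral_filter_of_dominated_convergence
      (fun s : ℝ => (2 ^ r * m ^ (2:ℝ)) * (s + m) ^ (-2:ℝ))
    · refine Eventually.of_forall (fun n => ?_)
      apply Measurable.aestronglyMeasurable
      apply Measurable.indicator _ measurableSet_Ioc
      have := hH.measurable
      fun_prop
    · filter_upwards [hb'] with n hn
      refine (ae_restrict_iff' measurableSet_Ioi).2 (Eventually.of_forall (fun s hs => ?_))
      have hs : 0 < s := hs
      have hbn : 0 ≤ (2 ^ r * m ^ (2:ℝ)) * (s + m) ^ (-2:ℝ) := by positivity
      simp only [hF]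
      by_cases hmem : s ∈ Set.Ioc 0 ((z n - x n) / f (x n))
      · rw [Set.indicator_of_mem hmem]
        have h0 : 0 ≤ H (f (x n) * s + x n) / H (x n) := div_nonneg (hH0 _) (hH0 _)
        rw [Real.norm_of_nonneg (by positivity)]
        have h1 : H (f (x n) * s + x n) / H (x n) ≤ 2 * ((s + m) / m) ^ (-(2 / r)) := by
          rw [div_le_iff₀ hn.1, show f (x n) * s + x n = x n + s * f (x n) by ring]
          exact hn.2 s hs.le
        calc _ ≤ (2 * ((s + m) / m) ^ (-(2 / r))) ^ r := Real.rpow_le_rpow h0 h1 hr.le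
          _ = _ := by
            rw [Real.mul_rpow (by norm_num) (by positivity), ← Real.rpow_mul (by positivity),
              show -(2 / r) * r = (-2:ℝ) by field_simp, Real.div_rpow (by positivity) hm.le,
              Real.rpow_neg hm.le]
            field_simp
      · rw [Set.indicator_of_notMem hmem, norm_zero]
        exact hbn
    · exact (integrableOn_add_rpow_Ioi_of_lt (by norm_num) (by linarith)).const_mul _
    · refine (ae_restrict_iff' measurableSet_Ioi).2 (Eventually.of_forall (fun s hs => ?_))
      have hs : 0 < s := hs
      have h1 := (h s).comp hx
      have h2 := h1.rpow_const (p := r) (Or.inr hr.le)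
      rw [← Real.exp_mul, show -s * r = -r * s by ring] at h2
      refine h2.congr' ?_
      filter_upwards [hz.eventually_lt h1 (Real.exp_pos _), hb'] with n g1 g2
      have hmem : s ∈ Set.Ioc 0 ((z n - x n) / f (x n)) := by
        refine ⟨hs, ?_⟩
        rw [le_div_iff₀ (hf _)]
        simp only [Function.comp] at g1
        rw [div_lt_div_iff_of_pos_right g2.1] at g1
        by_contra hc
        push Not at hc
        exact absurd (hH (show z n ≤ x n + s * f (x n) by linarith)) (not_le.2 g1)
      simp only [hF]
      rw [Set.indicator_of_mem hmem]
      simp only [Function.comp]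
      rw [show f (x n) * s + x n = x n + s * f (x n) by ring]
  rw [integral_exp_mul_Ioi (by linarith)] at key
  simp only [mul_zero, Real.exp_zero, neg_div_neg_eq] at key
  refine key.congr' ?_
  filter_upwards [hb'] with n hn
  have hfx := hf (x n)
  simp only [hF]
  rw [setIntegral_indicator measurableSet_Ioc,
    Set.inter_eq_right.2 Set.Ioc_subset_Ioi_self,
    ← intervalIntegral.integral_of_le (div_nonneg (by linarith [hxz n]) hfx.le),
    intervalIntegral.integral_comp_mul_add (fun t => (H t / H (x n)) ^ r) hfx.ne']
  have e1 : f (x n) * 0 + x n = x n := by ring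
  have e2 : f (x n) * ((z n - x n) / f (x n)) + x n = z n := by field_simp; ring
  rw [e1, e2]
  have e3 : ∀ t, (H t / H (x n)) ^ r = (H (x n) ^ r)⁻¹ * H t ^ r := by
    intro t
    rw [Real.div_rpow (hH0 _) (hH0 _), div_eq_mul_inv, mul_comm]
  simp_rw [e3]
  rw [intervalIntegral.integral_const_mul, smul_eq_mul]
  ring

lemma aux_filter (G : ℝ → ℝ) (hG : Monotone G) (hne : ∀ ε > 0, ∃ t, 0 < 1 - G t ∧ 1 - G t < ε) :
    Tendsto (fun t => 1 - G t) (upEndFilter G) (𝓝[>] 0) := by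
  have key : ∀ t, 0 < 1 - G t → ∀ᶠ y in upEndFilter G, t ≤ y ∧ 0 < 1 - G y := by
    intro t ht
    unfold upEndFilter
    split_ifs with hb
    · have hmem : ∀ ε > 0, ∃ t, 0 < 1 - G t ∧ 1 - G t < ε := hne
      have htl : t < upEnd G := by
        obtain ⟨u, hu1, hu2⟩ := hne _ ht
        have : t < u := by
          by_contra hc
          have := hG (not_lt.1 hc)
          linarith
        exact this.trans_le (le_csSup hb (show G u < 1 by linarith))
      filter_upwards [Ioo_mem_nhdsLT htl] with y hy
      refine ⟨hy.1.le, ?_⟩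
      obtain ⟨v, hv1, hv2⟩ := exists_lt_of_lt_csSup ⟨t, show G t < 1 by linarith⟩ hy.2
      have hv1 : G v < 1 := hv1
      have := hG hv2.le
      linarith
    · filter_upwards [eventually_ge_atTop t] with y hy
      refine ⟨hy, ?_⟩
      rw [not_bddAbove_iff] at hb
      obtain ⟨v, hv1, hv2⟩ := hb y
      have hv1 : G v < 1 := hv1
      have := hG hv2.le
      linarith
  rw [tendsto_nhdsWithin_iff]
  constructor
  · rw [tendsto_order]
    constructor
    · intro c hc
      obtain ⟨t, ht, _⟩ := hne 1 one_pos
      filter_upwards [key t ht] with y hy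
      exact hc.trans hy.2
    · intro c hc
      obtain ⟨t, ht, ht2⟩ := hne c hc
      filter_upwards [key t ht] with y hy
      have := hG hy.1
      linarith
  · obtain ⟨t, ht, _⟩ := hne 1 one_pos
    filter_upwards [key t ht] with y hy
    exact hy.2


/-- Lemma 3.3(ii). -/
theorem gumbel_power_transform (G : ℝ → ℝ) (hG : IsDF G)
    (hdom : MemDomAttr G gumbelDF) (r : ℝ) (hr : 0 < r)
    (Gr : ℝ → ℝ) (hGr : Gr = fun x => 1 - (1 - G x) ^ r) :
    MemDomAttr Gr gumbelDF ∧
    upEnd G = upEnd Gr ∧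
    (∀ x z : ℕ → ℝ,
      Tendsto x atTop (upEndFilter G) →
      Tendsto z atTop (upEndFilter G) →
      (∀ n, x n < z n) →
      Tendsto (fun n => (1 - G (z n)) / (1 - G (x n))) atTop (𝓝 0) →
      Tendsto (fun n => Rp 1 (x n) (z n) G / Rp 1 (x n) (z n) Gr) atTop (𝓝 r)) := by
  obtain ⟨hmono, -, hbot, htop⟩ := hG
  have hG0 : ∀ x, 0 ≤ G x := fun x => hmono.le_of_tendsto hbot x
  have hG1 : ∀ x, G x ≤ 1 := fun x => hmono.ge_of_tendsto htop x
  subst hGr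
  refine ⟨aux_part1 G hG0 hG1 hdom r hr, ?_, ?_⟩
  · unfold upEnd
    congr 1
    ext x
    simp only [Set.mem_ofPred_eq]
    have h1 : 0 ≤ 1 - G x := by linarith [hG1 x]
    constructor
    · intro h
      have : 0 < (1 - G x) ^ r := Real.rpow_pos_of_pos (by linarith) r
      linarith
    · intro h
      rcases h1.lt_or_eq with h2 | h2
      · linarith
      · rw [← h2, Real.zero_rpow hr.ne'] at h
        linarith
  · intro x z hx _ hxz hz
    obtain ⟨A, B, hA, h⟩ := aux_real G hG0 hdom
    set H : ℝ → ℝ := fun t => 1 - G t with hHdef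
    have hH : Antitone H := fun a b hab => by
      have := hmono hab
      simp only [hHdef]
      linarith
    have hH0 : ∀ t, 0 ≤ H t := fun t => by
      simp only [hHdef]
      linarith [hG1 t]
    have hne : ∀ ε > 0, ∃ t, 0 < 1 - G t ∧ 1 - G t < ε := by
      intro ε hε
      have h0 := h 0
      have h1 := h0.mul (tendsto_inv_atTop_zero (𝕜 := ℝ))
      rw [mul_zero] at h1
      obtain ⟨τ, g1, g2, g3⟩ := ((h0.eventually (lt_mem_nhds (Real.exp_pos _))).and
        ((h1.eventually (gt_mem_nhds hε)).and (eventually_gt_atTop 0))).exists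
      refine ⟨_, (pos_iff_pos_of_mul_pos g1).1 g3, ?_⟩
      refine lt_of_eq_of_lt ?_ g2
      field_simp
    have hx' : Tendsto x atTop (comap H (𝓝[>] 0)) :=
      tendsto_comap_iff.2 ((aux_filter G hmono hne).comp hx)
    have hf : ∀ t, 0 < A (H t)⁻¹ := fun t => hA _
    have hlim := aux_f H A B hH h hA
    have i1 := aux_int_s6 H (fun t => A (H t)⁻¹) hH hH0 hf hlim 1 one_pos x z hx' hxz hz
    have i2 := aux_int_s6 H (fun t => A (H t)⁻¹) hH hH0 hf hlim r hr x z hx' hxz hz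
    have i3 := i1.div i2 (by positivity)
    rw [div_one, one_div_one_div] at i3
    refine i3.congr (fun n => ?_)
    simp only [Pi.div_apply, Real.rpow_one]
    rw [div_div_div_cancel_right₀ (hf _).ne']
    simp [Rp, iterInt, hHdef]

end
end
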